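/- arXiv:1607.00579 — 2 statements merged into one kernel-verified Lean document; each statement's English description precedes it below -/
import Mathlib

section
/- Let R ∈ ℂ[U_0,…,U_t] be a multihomogeneous polynomial of multidegree (N_0,…,N_t) in independent families of indeterminates U_i = (U_{i,1},…,U_{i,n_i}), and for i = 0,…,t let u_i ∈ ℂ^{n_i} be nonzero and ε_i ∈ ℂ^{n_i} satisfy ‖ε_i‖ ≤ ‖u_i‖. Then |R(u_0+ε_0,…,u_t+ε_t) − R(u_0,…,u_t)| ≤ 2^{N_0+⋯+N_t} · L(R) · ‖u_0‖^{N_0} ⋯ ‖u_t‖^{N_t} · max( ‖ε_0‖/‖u_0‖, …, ‖ε_t‖/‖u_t‖ ). -/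
open scoped BigOperators

/-- The maximum norm `‖v‖ = max_j |v j|` of a finite family of complex numbers. -/
noncomputable def supNorm {n : ℕ} (v : Fin n → ℂ) : ℝ := ⨆ j, ‖v j‖

/-- The length `L(R)` of a polynomial with complex coefficients:
the sum of the absolute values of its coefficients. -/
noncomputable def lengthMv {σ : Type*} (R : MvPolynomial σ ℂ) : ℝ :=
  ∑ m ∈ R.support, ‖R.coeff m‖

def PertGood (δ : ℝ) (a' a : ℂ) (d : ℕ) (B : ℝ) : Prop :=
  ‖a‖ ≤ B ∧ ‖a' - a‖ ≤ (2 ^ d - 1) * δ * B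

theorem PertGood.mul {δ : ℝ} (h0 : 0 ≤ δ) (h1 : δ ≤ 1) {a' a c' c : ℂ} {d e : ℕ} {B C : ℝ}
    (h : PertGood δ a' a d B) (k : PertGood δ c' c e C) :
    PertGood δ (a' * c') (a * c) (d + e) (B * C) := by
  obtain ⟨ha, ha'⟩ := h
  obtain ⟨hc, hc'⟩ := k
  have hB : 0 ≤ B := (norm_nonneg _).trans ha
  have hC : 0 ≤ C := (norm_nonneg _).trans hc
  have hd : (0 : ℝ) ≤ 2 ^ d - 1 := sub_nonneg.2 (one_le_pow₀ (by norm_num))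
  have he : (0 : ℝ) ≤ 2 ^ e - 1 := sub_nonneg.2 (one_le_pow₀ (by norm_num))
  refine ⟨?_, ?_⟩
  · rw [norm_mul]; gcongr
  · have : a' * c' - a * c = (a' - a) * (c' - c) + (a' - a) * c + a * (c' - c) := by ring
    rw [this]
    calc _ ≤ ‖a' - a‖ * ‖c' - c‖ + ‖a' - a‖ * ‖c‖ + ‖a‖ * ‖c' - c‖ := by
          refine (norm_add₃_le).trans ?_
          simp only [norm_mul, le_refl]
      _ ≤ ((2 ^ d - 1) * δ * B) * ((2 ^ e - 1) * δ * C) + ((2 ^ d - 1) * δ * B) * C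
            + B * ((2 ^ e - 1) * δ * C) := by gcongr
      _ ≤ ((2 ^ d - 1) * δ * B) * ((2 ^ e - 1) * 1 * C) + ((2 ^ d - 1) * δ * B) * C
            + B * ((2 ^ e - 1) * δ * C) := by gcongr
      _ = _ := by rw [pow_add]; ring

theorem PertGood.one (δ : ℝ) : PertGood δ 1 1 0 1 := by simp [PertGood]

theorem PertGood.pow {δ : ℝ} (h0 : 0 ≤ δ) (h1 : δ ≤ 1) {a' a : ℂ} {B : ℝ}
    (h : PertGood δ a' a 1 B) (m : ℕ) : PertGood δ (a' ^ m) (a ^ m) m (B ^ m) := by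
  induction m with
  | zero => simpa using PertGood.one δ
  | succ m ih => simpa [pow_succ] using ih.mul h0 h1 h

theorem PertGood.prod {δ : ℝ} (h0 : 0 ≤ δ) (h1 : δ ≤ 1) {ι : Type*} (s : Finset ι)
    {a' a : ι → ℂ} {d : ι → ℕ} {B : ι → ℝ}
    (h : ∀ i, PertGood δ (a' i) (a i) (d i) (B i)) :
    PertGood δ (∏ i ∈ s, a' i) (∏ i ∈ s, a i) (∑ i ∈ s, d i) (∏ i ∈ s, B i) := by
  classical
  induction s using Finset.induction_on with
  | empty => simpa using PertGood.one δ
  | insert i s hi ih =>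
    rw [Finset.prod_insert hi, Finset.prod_insert hi, Finset.sum_insert hi, Finset.prod_insert hi]
    exact (h i).mul h0 h1 ih

theorem le_supNorm {n : ℕ} (v : Fin n → ℂ) (j : Fin n) : ‖v j‖ ≤ supNorm v :=
  le_ciSup (f := fun j => ‖v j‖) (Set.finite_range _).bddAbove j

theorem supNorm_pos {n : ℕ} {v : Fin n → ℂ} (h : v ≠ 0) : 0 < supNorm v := by
  obtain ⟨j, hj⟩ := Function.ne_iff.1 h
  exact (norm_pos_iff.2 hj).trans_le (le_supNorm v j)

/-- Let `R ∈ ℂ[U₀,…,U_t]` be multihomogeneous of multidegree `(N₀,…,N_t)` in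
independent families of indeterminates `U i = (U_{i,1},…,U_{i,n_i})`, and for
`i = 0,…,t` let `u i ∈ ℂ^{n_i}` be nonzero and `ε i ∈ ℂ^{n_i}` with
`‖ε i‖ ≤ ‖u i‖`.  Then
`|R(u+ε) − R(u)| ≤ 2^{N₀+⋯+N_t} L(R) ‖u₀‖^{N₀} ⋯ ‖u_t‖^{N_t} max_i (‖ε i‖/‖u i‖)`. -/
theorem multihomogeneous_perturbation_bound
    (t : ℕ) (n : Fin (t + 1) → ℕ) (hn : ∀ i, 1 ≤ n i)
    (N : Fin (t + 1) → ℕ)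
    (R : MvPolynomial (Σ i : Fin (t + 1), Fin (n i)) ℂ)
    (hR : ∀ p ∈ R.support, ∀ i : Fin (t + 1), ∑ j, p ⟨i, j⟩ = N i)
    (u ε : ∀ i : Fin (t + 1), Fin (n i) → ℂ)
    (hu : ∀ i, u i ≠ 0)
    (hε : ∀ i, supNorm (ε i) ≤ supNorm (u i)) :
    ‖MvPolynomial.eval (fun p => u p.1 p.2 + ε p.1 p.2) R
        - MvPolynomial.eval (fun p => u p.1 p.2) R‖
      ≤ 2 ^ (∑ i, N i) * lengthMv R * (∏ i, supNorm (u i) ^ N i)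
          * ⨆ i, supNorm (ε i) / supNorm (u i) := by
  have hpos : ∀ i, 0 < supNorm (u i) := fun i => supNorm_pos (hu i)
  have hεn : ∀ i, 0 ≤ supNorm (ε i) := fun i => Real.iSup_nonneg fun _ => norm_nonneg _
  set δ := ⨆ i, supNorm (ε i) / supNorm (u i) with hδ
  have h0 : 0 ≤ δ := Real.iSup_nonneg fun i => div_nonneg (hεn i) (hpos i).le
  have h1 : δ ≤ 1 := ciSup_le fun i => (div_le_one (hpos i)).2 (hε i)
  have hle : ∀ i, supNorm (ε i) ≤ δ * supNorm (u i) := fun i => by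
    rw [← div_le_iff₀ (hpos i)]
    exact le_ciSup (f := fun i => supNorm (ε i) / supNorm (u i)) (Set.finite_range _).bddAbove i
  have hbase : ∀ q : (Σ i : Fin (t + 1), Fin (n i)),
      PertGood δ (u q.1 q.2 + ε q.1 q.2) (u q.1 q.2) 1 (supNorm (u q.1)) := fun q => by
    refine ⟨le_supNorm _ _, ?_⟩
    have := (le_supNorm (ε q.1) q.2).trans (hle q.1)
    rw [add_sub_cancel_left]
    linarith
  have hB : 0 ≤ ∏ i, supNorm (u i) ^ N i := Finset.prod_nonneg fun i _ => pow_nonneg (hpos i).le _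
  rw [MvPolynomial.eval_eq', MvPolynomial.eval_eq', ← Finset.sum_sub_distrib, lengthMv,
    Finset.mul_sum, Finset.sum_mul, Finset.sum_mul]
  refine (norm_sum_le _ _).trans (Finset.sum_le_sum fun p hp => ?_)
  have key := (PertGood.prod h0 h1 Finset.univ fun q => (hbase q).pow h0 h1 (p q)).2
  have e1 : ∑ q, p q = ∑ i, N i := by
    rw [Fintype.sum_sigma]
    exact Finset.sum_congr rfl fun i _ => hR p hp i
  have e2 : ∏ q : (Σ i : Fin (t + 1), Fin (n i)), supNorm (u q.1) ^ p q
      = ∏ i, supNorm (u i) ^ N i := by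
    rw [Fintype.prod_sigma]
    refine Finset.prod_congr rfl fun i _ => ?_
    rw [← hR p hp i]
    exact Finset.prod_pow_eq_pow_sum Finset.univ (fun j => p ⟨i, j⟩) (supNorm (u i))
  rw [e1, e2] at key
  rw [← mul_sub, norm_mul]
  have key2 := mul_le_mul_of_nonneg_left key (norm_nonneg (R.coeff p))
  have : 0 ≤ ‖R.coeff p‖ * (δ * ∏ i, supNorm (u i) ^ N i) := by positivity
  refine key2.trans ?_
  linarith
end

section
/- Let K ⊂ ℂ be a number field of degree d, let Q_0,…,Q_t be homogeneous polynomials in K[X_0,…,X_t] of respective degrees D_0,…,D_t ≥ 1 with no common zero in ℙ^t(ℂ) (i.e., no common nonzero zero in ℂ^{t+1}), and let (ξ_1,…,ξ_t) ∈ ℂ^t. For i = 0,…,t set δ_i = Q_i(1,ξ_1,…,ξ_t). Then 1 ≤ (t+1)^{4d(t+1)D_0⋯D_t} · ( ∏_{i=0}^t H(Q_i)^{d D_0⋯D_t / D_i} ) · max( |δ_0|/‖Q_0‖, …, |δ_t|/‖Q_t‖ ). -/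
open scoped BigOperators

/-- `H_∞(u) = (∏_σ max_i |σ (u i)|)^{1/d}`, the product over the `d`
embeddings `σ : K → ℂ` of the number field `K`. -/
noncomputable def HinfV (K : IntermediateField ℚ ℂ) [NumberField K]
    {ι : Type*} [Fintype ι] (u : ι → K) : ℝ :=
  (∏ σ : K →+* ℂ, ⨆ i, ‖σ (u i)‖) ^ ((Module.finrank ℚ K : ℝ))⁻¹

/-- `H_fin(u) = N_{K/ℚ}(𝔞)^{-1/d}`, where `𝔞` is the fractional ideal of `K`
generated by the coordinates of `u`. -/
noncomputable def HfinV (K : IntermediateField ℚ ℂ) [NumberField K]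
    {ι : Type*} [Fintype ι] (u : ι → K) : ℝ :=
  ((FractionalIdeal.absNorm (FractionalIdeal.spanFinset (NumberField.RingOfIntegers K)
      (Finset.univ : Finset ι) u) : ℚ) : ℝ) ^ (-(Module.finrank ℚ K : ℝ)⁻¹)

/-- The absolute Weil height `H(u) = H_∞(u) · H_fin(u)`. -/
noncomputable def HV (K : IntermediateField ℚ ℂ) [NumberField K]
    {ι : Type*} [Fintype ι] (u : ι → K) : ℝ := HinfV K u * HfinV K u

/-- The height `H(P)` of a nonzero polynomial with coefficients in `K`:
the height of its vector of coefficients. -/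
noncomputable def polyH (K : IntermediateField ℚ ℂ) [NumberField K] {t : ℕ}
    (Q : MvPolynomial (Fin (t + 1)) K) : ℝ :=
  HV K (fun m : ↥Q.support => Q.coeff m)

/-- `‖Q‖`: the maximum of the absolute values of the coefficients of `Q`. -/
noncomputable def polyNorm (K : IntermediateField ℚ ℂ) {t : ℕ}
    (Q : MvPolynomial (Fin (t + 1)) K) : ℝ :=
  ⨆ m : ↥Q.support, ‖((Q.coeff m : K) : ℂ)‖

section WrapP1
open scoped BigOperators

abbrev Col (t N : ℕ) := ↥(Finset.finsuppAntidiag (Finset.univ : Finset (Fin (t + 1))) N)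

noncomputable def rowP {R : Type*} [CommRing R] {t : ℕ}
    (Q : Fin (t + 1) → MvPolynomial (Fin (t + 1)) R) (b : Fin (t + 1) → ℕ)
    (μ : Fin (t + 1) →₀ ℕ) : MvPolynomial (Fin (t + 1)) R :=
  (∏ i, Q i ^ b i) * MvPolynomial.monomial μ 1

noncomputable def rowMat {R : Type*} [CommRing R] {t N : ℕ}
    (Q : Fin (t + 1) → MvPolynomial (Fin (t + 1)) R) (b : Col t N → Fin (t + 1) → ℕ)
    (μ : Col t N → Fin (t + 1) →₀ ℕ) : Matrix (Col t N) (Col t N) R :=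
  Matrix.of fun s s' => MvPolynomial.coeff (s' : Fin (t + 1) →₀ ℕ) (rowP Q (b s) (μ s))

lemma rowP_map {R S : Type*} [CommRing R] [CommRing S] (f : R →+* S) {t : ℕ}
    (Q : Fin (t + 1) → MvPolynomial (Fin (t + 1)) R) (b : Fin (t + 1) → ℕ)
    (μ : Fin (t + 1) →₀ ℕ) :
    rowP (fun i => MvPolynomial.map f (Q i)) b μ = MvPolynomial.map f (rowP Q b μ) := by
  simp [rowP, map_prod]

lemma rowMat_map_det {R S : Type*} [CommRing R] [CommRing S] (f : R →+* S) {t N : ℕ}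
    (Q : Fin (t + 1) → MvPolynomial (Fin (t + 1)) R) (b : Col t N → Fin (t + 1) → ℕ)
    (μ : Col t N → Fin (t + 1) →₀ ℕ) :
    (rowMat (fun i => MvPolynomial.map f (Q i)) b μ).det = f (rowMat Q b μ).det := by
  rw [RingHom.map_det]
  congr 1
  ext s s'
  simp [rowMat, rowP_map, MvPolynomial.coeff_map]

lemma mem_col {t N : ℕ} {s : Fin (t + 1) →₀ ℕ} :
    s ∈ Finset.finsuppAntidiag (Finset.univ : Finset (Fin (t + 1))) N ↔ s.degree = N := by
  rw [Finset.mem_finsuppAntidiag]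
  simp [Finsupp.degree_eq_sum]

lemma card_col (t N : ℕ) : Fintype.card (Col t N) = (N + t).choose t := by
  rw [Fintype.card_coe, Finset.card_finsuppAntidiag_nat_eq_choose]
  simp
  rw [← Nat.choose_symm_add]
  congr 1
  omega

/-- l1 norm -/
noncomputable def l1 {t : ℕ} (p : MvPolynomial (Fin (t + 1)) ℂ) : ℝ :=
  ∑ m ∈ p.support, ‖p.coeff m‖

lemma l1_eq {t : ℕ} (p : MvPolynomial (Fin (t + 1)) ℂ) (s : Finset (Fin (t + 1) →₀ ℕ))
    (h : p.support ⊆ s) : l1 p = ∑ m ∈ s, ‖p.coeff m‖ := by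
  apply Finset.sum_subset h
  intro m _ hm
  simpa using hm

lemma sum_le_l1 {t : ℕ} (p : MvPolynomial (Fin (t + 1)) ℂ) (s : Finset (Fin (t + 1) →₀ ℕ)) :
    ∑ m ∈ s, ‖p.coeff m‖ ≤ l1 p := by
  rw [l1_eq p (p.support ∪ s) Finset.subset_union_left]
  exact Finset.sum_le_sum_of_subset_of_nonneg Finset.subset_union_right (fun _ _ _ => norm_nonneg _)

lemma l1_nonneg {t : ℕ} (p : MvPolynomial (Fin (t + 1)) ℂ) : 0 ≤ l1 p :=
  Finset.sum_nonneg fun _ _ => norm_nonneg _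

lemma l1_add {t : ℕ} (p q : MvPolynomial (Fin (t + 1)) ℂ) : l1 (p + q) ≤ l1 p + l1 q := by
  classical
  rw [l1_eq (p + q) (p.support ∪ q.support) MvPolynomial.support_add,
    l1_eq p (p.support ∪ q.support) Finset.subset_union_left,
    l1_eq q (p.support ∪ q.support) Finset.subset_union_right, ← Finset.sum_add_distrib]
  apply Finset.sum_le_sum
  intro m _
  rw [MvPolynomial.coeff_add]
  exact norm_add_le _ _

lemma l1_zero {t : ℕ} : l1 (0 : MvPolynomial (Fin (t + 1)) ℂ) = 0 := by simp [l1]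

lemma l1_sum {t : ℕ} {ι : Type*} (s : Finset ι) (f : ι → MvPolynomial (Fin (t + 1)) ℂ) :
    l1 (∑ i ∈ s, f i) ≤ ∑ i ∈ s, l1 (f i) :=
  Finset.le_sum_of_subadditive _ l1_zero.le l1_add s f

lemma l1_monomial {t : ℕ} (m : Fin (t + 1) →₀ ℕ) (c : ℂ) :
    l1 (MvPolynomial.monomial m c) = ‖c‖ := by
  classical
  rw [l1_eq _ {m} MvPolynomial.support_monomial_subset]
  simp

lemma l1_monomial_mul {t : ℕ} (m : Fin (t + 1) →₀ ℕ) (c : ℂ) (q : MvPolynomial (Fin (t + 1)) ℂ) :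
    l1 (MvPolynomial.monomial m c * q) ≤ ‖c‖ * l1 q := by
  classical
  have : MvPolynomial.monomial m c * q
      = ∑ k ∈ q.support, MvPolynomial.monomial (m + k) (c * q.coeff k) := by
    conv_lhs => rw [q.as_sum, Finset.mul_sum]
    simp [MvPolynomial.monomial_mul]
  rw [this]
  refine (l1_sum _ _).trans ?_
  simp only [l1_monomial]
  simp [l1, Finset.mul_sum]

lemma l1_mul {t : ℕ} (p q : MvPolynomial (Fin (t + 1)) ℂ) : l1 (p * q) ≤ l1 p * l1 q := by
  conv_lhs => rw [p.as_sum, Finset.sum_mul]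
  refine (l1_sum _ _).trans ?_
  rw [l1, Finset.sum_mul]
  exact Finset.sum_le_sum fun m _ => l1_monomial_mul _ _ _

lemma l1_one {t : ℕ} : l1 (1 : MvPolynomial (Fin (t + 1)) ℂ) = 1 := by
  have := l1_monomial (t := t) 0 1
  simpa using this

lemma l1_pow {t : ℕ} (p : MvPolynomial (Fin (t + 1)) ℂ) (n : ℕ) : l1 (p ^ n) ≤ l1 p ^ n := by
  induction n with
  | zero => simp [l1_one]
  | succ n ih =>
    rw [pow_succ, pow_succ]
    exact (l1_mul _ _).trans (mul_le_mul_of_nonneg_right ih (l1_nonneg _))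

lemma l1_prod {t : ℕ} {ι : Type*} (s : Finset ι) (f : ι → MvPolynomial (Fin (t + 1)) ℂ) :
    l1 (∏ i ∈ s, f i) ≤ ∏ i ∈ s, l1 (f i) := by
  classical
  induction s using Finset.induction_on with
  | empty => simp [l1_one]
  | insert a s ha ih =>
    rw [Finset.prod_insert ha, Finset.prod_insert ha]
    exact (l1_mul _ _).trans (mul_le_mul_of_nonneg_left ih (l1_nonneg _))

lemma l1_rowP {t : ℕ} (Q : Fin (t + 1) → MvPolynomial (Fin (t + 1)) ℂ) (b : Fin (t + 1) → ℕ)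
    (μ : Fin (t + 1) →₀ ℕ) (c : Fin (t + 1) → ℝ) (hc : ∀ i, l1 (Q i) ≤ c i) :
    l1 (rowP Q b μ) ≤ ∏ i, c i ^ b i := by
  unfold rowP
  refine (l1_mul _ _).trans ?_
  rw [l1_monomial, norm_one, mul_one]
  refine (l1_prod _ _).trans ?_
  apply Finset.prod_le_prod
  · intro i _; exact l1_nonneg _
  · intro i _
    exact (l1_pow _ _).trans (pow_le_pow_left₀ (l1_nonneg _) (hc i) _)

lemma norm_det_le {n : Type*} [Fintype n] [DecidableEq n] (A : Matrix n n ℂ) :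
    ‖A.det‖ ≤ ∏ i, ∑ j, ‖A i j‖ := by
  rw [← Matrix.det_transpose, Matrix.det_apply]
  refine (norm_sum_le _ _).trans ?_
  rw [Finset.prod_univ_sum]
  have h1 : ∀ σ : Equiv.Perm n, ‖Equiv.Perm.sign σ • ∏ i, A.transpose (σ i) i‖
      = ∏ i, ‖A i (σ i)‖ := by
    intro σ
    rcases Int.units_eq_one_or (Equiv.Perm.sign σ) with h | h <;> simp [h, norm_prod]
  simp only [h1]
  let e : Equiv.Perm n ↪ (n → n) := ⟨fun σ => σ, fun a b h => Equiv.ext (congrFun h)⟩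
  have : ∑ σ : Equiv.Perm n, ∏ i, ‖A i (σ i)‖
      = ∑ f ∈ Finset.univ.map e, ∏ i, ‖A i (f i)‖ := by
    rw [Finset.sum_map]; rfl
  rw [this]
  apply Finset.sum_le_sum_of_subset_of_nonneg
  · intro f _; simp
  · intro f _ _; exact Finset.prod_nonneg fun _ _ => norm_nonneg _

lemma norm_rowMat_det_le {t N : ℕ} (Q : Fin (t + 1) → MvPolynomial (Fin (t + 1)) ℂ)
    (b : Col t N → Fin (t + 1) → ℕ)
    (μ : Col t N → Fin (t + 1) →₀ ℕ) (c : Fin (t + 1) → ℝ) (hc : ∀ i, l1 (Q i) ≤ c i) :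
    ‖(rowMat Q b μ).det‖ ≤ ∏ i, c i ^ (∑ s, b s i) := by
  refine (norm_det_le _).trans ?_
  have : ∏ i, c i ^ (∑ s, b s i) = ∏ s, ∏ i, c i ^ b s i := by
    rw [Finset.prod_comm]
    exact Finset.prod_congr rfl fun i _ => (Finset.prod_pow_eq_pow_sum _ _ _).symm
  rw [this]
  apply Finset.prod_le_prod
  · intro i _; exact Finset.sum_nonneg fun _ _ => norm_nonneg _
  · intro s _
    refine le_trans ?_ (l1_rowP Q (b s) (μ s) c hc)
    have := sum_le_l1 (rowP Q (b s) (μ s)) (Finset.finsuppAntidiag Finset.univ N)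
    rw [← Finset.sum_coe_sort] at this
    exact this

/-- Schwarz lemma for polynomials. -/
lemma schwarz_poly (F : Polynomial ℂ) (m : ℕ) (hF : Polynomial.X ^ m ∣ F) (ε B : ℝ)
    (h0 : 0 < ε) (h1 : ε < 1) (hB : ∀ z : ℂ, ‖z‖ = ε⁻¹ → ‖F.eval z‖ ≤ B) :
    ‖F.eval 1‖ ≤ ε ^ m * B := by
  obtain ⟨G, rfl⟩ := hF
  have hε : 0 < ε⁻¹ := inv_pos.mpr h0
  have key : ‖G.eval 1‖ ≤ ε ^ m * B := by
    refine Complex.norm_le_of_forall_mem_frontier_norm_le (U := Metric.ball (0:ℂ) ε⁻¹)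
      Metric.isBounded_ball (f := fun z => G.eval z) ?_ ?_ ?_
    · exact G.differentiable.diffContOnCl
    · intro z hz
      rw [frontier_ball _ hε.ne'] at hz
      have hz' : ‖z‖ = ε⁻¹ := by simpa using hz
      have := hB z hz'
      simp only [Polynomial.eval_mul, Polynomial.eval_pow, Polynomial.eval_X, norm_mul, norm_pow,
        hz'] at this
      calc ‖G.eval z‖ = ε ^ m * (ε⁻¹ ^ m * ‖G.eval z‖) := by
            rw [← mul_assoc, ← mul_pow, mul_inv_cancel₀ h0.ne']; simp
        _ ≤ _ := by gcongr
    · apply subset_closure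
      simp only [Metric.mem_ball, dist_zero_right, norm_one]
      exact (one_lt_inv₀ h0).mpr h1
  simpa using key

end WrapP1

section WrapP2
open scoped BigOperators nonZeroDivisors NumberField

section P2
variable {K : Type*} [Field K] [NumberField K]

lemma absNorm_le_of_mem (I : FractionalIdeal (𝓞 K)⁰ K) (x : K) (hx : x ≠ 0) (hxI : x ∈ I) :
    FractionalIdeal.absNorm I ≤ |Algebra.norm ℚ x| := by
  have hI : I ≠ 0 := by
    rintro rfl
    exact hx (by simpa using hxI)
  have h1 : FractionalIdeal.spanSingleton (𝓞 K)⁰ x ≤ I := by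
    rwa [FractionalIdeal.spanSingleton_le_iff_mem]
  have h2 : FractionalIdeal.spanSingleton (𝓞 K)⁰ x * I⁻¹ ≤ 1 := by
    calc _ ≤ I * I⁻¹ := by gcongr
      _ = 1 := mul_inv_cancel₀ hI
  obtain ⟨J, hJ⟩ := FractionalIdeal.le_one_iff_exists_coeIdeal.mp h2
  have h3 : FractionalIdeal.spanSingleton (𝓞 K)⁰ x = (J : FractionalIdeal (𝓞 K)⁰ K) * I := by
    rw [hJ, mul_assoc, inv_mul_cancel₀ hI, mul_one]
  have hJ0 : J ≠ ⊥ := by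
    rintro rfl
    simp at h3
    exact hx (FractionalIdeal.spanSingleton_eq_zero_iff.mp h3)
  rw [← FractionalIdeal.absNorm_span_singleton (R := 𝓞 K), h3, map_mul,
    FractionalIdeal.coeIdeal_absNorm]
  have : 1 ≤ Ideal.absNorm J := by
    rw [Nat.one_le_iff_ne_zero]
    rwa [Ne, Ideal.absNorm_eq_zero_iff]
  have h5 : (1:ℚ) ≤ Ideal.absNorm J := by exact_mod_cast this
  nlinarith [FractionalIdeal.absNorm_nonneg I]

def CIn {t : ℕ} (I : FractionalIdeal (𝓞 K)⁰ K) (p : MvPolynomial (Fin (t + 1)) K) : Prop :=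
  ∀ m, p.coeff m ∈ I

lemma mem_sum' {ι : Type*} (I : FractionalIdeal (𝓞 K)⁰ K) (s : Finset ι) (f : ι → K)
    (h : ∀ i ∈ s, f i ∈ I) : ∑ i ∈ s, f i ∈ I := by
  have : ∑ i ∈ s, f i ∈ (I : Submodule (𝓞 K) K) := Submodule.sum_mem _ fun i hi => h i hi
  exact this

lemma mem_prod' {ι : Type*} (s : Finset ι) (I : ι → FractionalIdeal (𝓞 K)⁰ K) (f : ι → K)
    (h : ∀ i ∈ s, f i ∈ I i) : ∏ i ∈ s, f i ∈ ∏ i ∈ s, I i := by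
  classical
  induction s using Finset.induction_on with
  | empty => simpa using FractionalIdeal.one_mem_one _
  | insert a s ha ih =>
    rw [Finset.prod_insert ha, Finset.prod_insert ha]
    exact FractionalIdeal.mul_mem_mul (h a (by simp)) (ih fun i hi => h i (by simp [hi]))

lemma CIn.mul {t : ℕ} {I J : FractionalIdeal (𝓞 K)⁰ K} {p q : MvPolynomial (Fin (t + 1)) K}
    (hp : CIn I p) (hq : CIn J q) : CIn (I * J) (p * q) := by
  classical
  intro m
  rw [MvPolynomial.coeff_mul]
  exact mem_sum' _ _ _ fun x _ => FractionalIdeal.mul_mem_mul (hp _) (hq _)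

lemma CIn_monomial {t : ℕ} (μ : Fin (t + 1) →₀ ℕ) :
    CIn (1 : FractionalIdeal (𝓞 K)⁰ K) (MvPolynomial.monomial μ (1 : K)) := by
  classical
  intro m
  rw [MvPolynomial.coeff_monomial]
  split_ifs
  · exact FractionalIdeal.one_mem_one _
  · exact FractionalIdeal.zero_mem _

lemma CIn.pow {t : ℕ} {I : FractionalIdeal (𝓞 K)⁰ K} {p : MvPolynomial (Fin (t + 1)) K}
    (hp : CIn I p) (n : ℕ) : CIn (I ^ n) (p ^ n) := by
  induction n with
  | zero => simpa using CIn_monomial (K := K) (t := t) 0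
  | succ n ih => rw [pow_succ, pow_succ]; exact ih.mul hp

lemma CIn_prod {t : ℕ} {ι : Type*} (s : Finset ι) (I : ι → FractionalIdeal (𝓞 K)⁰ K)
    (p : ι → MvPolynomial (Fin (t + 1)) K)
    (h : ∀ i ∈ s, CIn (I i) (p i)) : CIn (∏ i ∈ s, I i) (∏ i ∈ s, p i) := by
  classical
  induction s using Finset.induction_on with
  | empty => simpa using CIn_monomial (K := K) (t := t) 0
  | insert a s ha ih =>
    rw [Finset.prod_insert ha, Finset.prod_insert ha]
    exact (h a (by simp)).mul (ih fun i hi => h i (by simp [hi]))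

lemma det_mem {t N : ℕ} (Q : Fin (t + 1) → MvPolynomial (Fin (t + 1)) K)
    (b : Col t N → Fin (t + 1) → ℕ) (μ : Col t N → Fin (t + 1) →₀ ℕ)
    (I : Fin (t + 1) → FractionalIdeal (𝓞 K)⁰ K) (hI : ∀ i, CIn (I i) (Q i)) :
    (rowMat Q b μ).det ∈ ∏ i, I i ^ (∑ s, b s i) := by
  have : ∏ i, I i ^ (∑ s, b s i) = ∏ s, ∏ i, I i ^ b s i := by
    rw [Finset.prod_comm]
    exact Finset.prod_congr rfl fun i _ => (Finset.prod_pow_eq_pow_sum _ _ _).symm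
  rw [this, ← Matrix.det_transpose, Matrix.det_apply]
  apply mem_sum'
  intro σ _
  have key : ∏ i, (rowMat Q b μ).transpose (σ i) i ∈ ∏ s, ∏ i, I i ^ b s i := by
    apply mem_prod'
    intro s _
    have : CIn (∏ i, I i ^ b s i) (rowP Q (b s) (μ s)) := by
      have := (CIn_prod Finset.univ (fun i => I i ^ b s i) (fun i => Q i ^ b s i)
        (fun i _ => (hI i).pow _)).mul (CIn_monomial (μ s))
      rwa [mul_one] at this
    exact this _
  rcases Int.units_eq_one_or (Equiv.Perm.sign σ) with h | h
  · simpa [h] using key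
  · rw [h]
    simp only [Units.neg_smul, one_smul]
    exact (Submodule.neg_mem_iff _).mpr key

lemma norm_eq_prod (x : K) : ((|Algebra.norm ℚ x| : ℚ) : ℝ) = ∏ σ : K →+* ℂ, ‖σ x‖ := by
  rw [← norm_prod]
  have h := Algebra.norm_eq_prod_embeddings ℚ ℂ x
  have h2 : ∏ σ : K →ₐ[ℚ] ℂ, σ x = ∏ σ : K →+* ℂ, σ x :=
    Fintype.prod_equiv (RingHom.equivRatAlgHom K ℂ).symm _ _ (fun σ => by simp)
  rw [← h2, ← h]
  simp
end P2

section P2b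
variable (K : IntermediateField ℚ ℂ) [NumberField K]

noncomputable def cIdeal {t : ℕ} (Q : MvPolynomial (Fin (t + 1)) K) :
    FractionalIdeal (𝓞 K)⁰ K :=
  FractionalIdeal.spanFinset (NumberField.RingOfIntegers K)
      (Finset.univ : Finset ↥Q.support) (fun m : ↥Q.support => Q.coeff m)

lemma CIn_cIdeal {t : ℕ} (Q : MvPolynomial (Fin (t + 1)) K) : CIn (cIdeal K Q) Q := by
  intro m
  by_cases hm : m ∈ Q.support
  · have : Q.coeff m ∈ (cIdeal K Q : Submodule (𝓞 K) K) := by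
      rw [cIdeal, FractionalIdeal.spanFinset_coe]
      exact Submodule.subset_span ⟨⟨m, hm⟩, by simp, rfl⟩
    exact this
  · rw [MvPolynomial.notMem_support_iff.mp hm]
    exact FractionalIdeal.zero_mem _

/-- sup norm at an embedding -/
noncomputable def sN {t : ℕ} (Q : MvPolynomial (Fin (t + 1)) K) (σ : K →+* ℂ) : ℝ :=
  ⨆ m : ↥Q.support, ‖σ (Q.coeff m)‖

lemma le_sN {t : ℕ} (Q : MvPolynomial (Fin (t + 1)) K) (σ : K →+* ℂ) (m) :
    ‖σ (Q.coeff m)‖ ≤ sN K Q σ := by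
  by_cases hm : m ∈ Q.support
  · exact le_ciSup (f := fun m : ↥Q.support => ‖σ (Q.coeff m)‖)
      (Set.finite_range _).bddAbove ⟨m, hm⟩
  · rw [MvPolynomial.notMem_support_iff.mp hm, map_zero, norm_zero]
    exact Real.iSup_nonneg fun _ => norm_nonneg _

lemma sN_nonneg {t : ℕ} (Q : MvPolynomial (Fin (t + 1)) K) (σ : K →+* ℂ) : 0 ≤ sN K Q σ :=
  Real.iSup_nonneg fun _ => norm_nonneg _

lemma sN_pos {t : ℕ} (Q : MvPolynomial (Fin (t + 1)) K) (hQ : Q ≠ 0) (σ : K →+* ℂ) :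
    0 < sN K Q σ := by
  obtain ⟨m, hm⟩ := MvPolynomial.ne_zero_iff.mp hQ
  refine lt_of_lt_of_le ?_ (le_sN K Q σ m)
  simpa using hm

lemma absNorm_cIdeal_pos {t : ℕ} (Q : MvPolynomial (Fin (t + 1)) K) (hQ : Q ≠ 0) :
    0 < ((FractionalIdeal.absNorm (cIdeal K Q) : ℚ) : ℝ) := by
  have h0 : cIdeal K Q ≠ 0 := by
    obtain ⟨m, hm⟩ := MvPolynomial.ne_zero_iff.mp hQ
    intro h
    have := CIn_cIdeal K Q m
    rw [h] at this
    exact hm (by simpa using this)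
  have : FractionalIdeal.absNorm (cIdeal K Q) ≠ 0 := by
    rwa [Ne, FractionalIdeal.absNorm_eq_zero_iff]
  have h2 := lt_of_le_of_ne (FractionalIdeal.absNorm_nonneg _) this.symm
  exact_mod_cast h2

lemma polyH_pow {t : ℕ} (Q : MvPolynomial (Fin (t + 1)) K) :
    polyH K Q ^ (Module.finrank ℚ K) =
      (∏ σ : K →+* ℂ, sN K Q σ) / ((FractionalIdeal.absNorm (cIdeal K Q) : ℚ) : ℝ) := by
  have hd : Module.finrank ℚ K ≠ 0 := Module.finrank_pos.ne'
  unfold polyH HV HinfV HfinV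
  rw [mul_pow, Real.rpow_inv_natCast_pow _ hd, Real.rpow_neg, inv_pow,
    Real.rpow_inv_natCast_pow _ hd, div_eq_mul_inv]
  · rfl
  · exact_mod_cast FractionalIdeal.absNorm_nonneg _
  · exact_mod_cast FractionalIdeal.absNorm_nonneg _
  · exact Finset.prod_nonneg fun σ _ => sN_nonneg K Q σ

lemma one_le_polyH_pow {t : ℕ} (Q : MvPolynomial (Fin (t + 1)) K) (hQ : Q ≠ 0) :
    1 ≤ polyH K Q ^ (Module.finrank ℚ K) := by
  rw [polyH_pow, one_le_div (absNorm_cIdeal_pos K Q hQ)]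
  obtain ⟨m, hm⟩ := MvPolynomial.ne_zero_iff.mp hQ
  have h := absNorm_le_of_mem (cIdeal K Q) _ hm (CIn_cIdeal K Q m)
  have h' : ((FractionalIdeal.absNorm (cIdeal K Q) : ℚ) : ℝ)
    ≤ ((|Algebra.norm ℚ (Q.coeff m)| : ℚ) : ℝ) := by exact_mod_cast h
  refine h'.trans ?_
  rw [norm_eq_prod]
  exact Finset.prod_le_prod (fun _ _ => norm_nonneg _) fun σ _ => le_sN K Q σ m

lemma prod_absNorm_le {t N : ℕ} (Q : Fin (t + 1) → MvPolynomial (Fin (t + 1)) K)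
    (b : Col t N → Fin (t + 1) → ℕ) (μ : Col t N → Fin (t + 1) →₀ ℕ)
    (hdet : (rowMat Q b μ).det ≠ 0) :
    ∏ i, ((FractionalIdeal.absNorm (cIdeal K (Q i)) : ℚ) : ℝ) ^ (∑ s, b s i)
      ≤ ∏ σ : K →+* ℂ, ‖σ (rowMat Q b μ).det‖ := by
  rw [← norm_eq_prod]
  have := absNorm_le_of_mem _ _ hdet (det_mem Q b μ (fun i => cIdeal K (Q i))
    (fun i => CIn_cIdeal K (Q i)))
  rw [map_prod] at this
  simp only [map_pow] at this
  exact_mod_cast this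
end P2b

end WrapP2

section WrapP3
open scoped BigOperators Topology

section P3
open Polynomial

lemma coker_lemma {n : Type*} [Fintype n] [DecidableEq n] (m : ℕ) :
    ∀ (A : Matrix n n ℂ[X]) (g : ℂ[X]), A.det = X ^ m * g → g.eval 0 ≠ 0 →
    ∃ φ : Fin m → ((n → ℂ[X]) →ₗ[ℂ] ℂ), ∀ v, (∀ j, φ j v = 0) →
      ∃ w, g • v = Matrix.vecMul w A := by
  induction m with
  | zero =>
    intro A g hA hg
    refine ⟨fun j => j.elim0, fun v _ => ⟨Matrix.vecMul v A.adjugate, ?_⟩⟩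
    rw [Matrix.vecMul_vecMul, Matrix.adjugate_mul, hA]
    simp [Matrix.vecMul_smul]
  | succ m ih =>
    intro A g hA hg
    have h0 : (A.map (eval 0)).det = 0 := by
      have := RingHom.map_det (evalRingHom (0:ℂ)) A
      rw [hA] at this
      simp at this
      exact this.symm
    obtain ⟨c, hc0, hc⟩ := Matrix.exists_vecMul_eq_zero_iff.mpr h0
    obtain ⟨i0, hi0⟩ : ∃ i, c i ≠ 0 := Function.ne_iff.mp hc0
    have hu : ∀ j, ∃ u', Matrix.vecMul (fun i => C (c i)) A j = X * u' := by
      intro j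
      have : X ∣ Matrix.vecMul (fun i => C (c i)) A j := by
        rw [X_dvd_iff, coeff_zero_eq_eval_zero]
        have := congrFun hc j
        simp only [Matrix.vecMul, dotProduct, Matrix.map_apply, Pi.zero_apply] at this ⊢
        rw [eval_finsetSum]
        simpa using this
      exact this
    choose u' hu' using hu
    set A' := A.updateRow i0 u' with hA'
    have hdet : A'.det = X ^ m * (C (c i0) * g) := by
      have h1 := Matrix.det_updateRow_sum A i0 (fun i => C (c i))
      have h2 : (∑ k, (C (c k)) • A k) = (X : ℂ[X]) • u' := by
        ext1 j
        rw [Pi.smul_apply, smul_eq_mul, ← hu']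
        simp [Matrix.vecMul, dotProduct]
      rw [h2, Matrix.det_updateRow_smul, hA] at h1
      have : (X : ℂ[X]) ≠ 0 := X_ne_zero
      apply mul_left_cancel₀ this
      rw [hA', h1, smul_eq_mul]
      ring
    obtain ⟨φ, hφ⟩ := ih A' (C (c i0) * g) hdet (by simp [hi0, hg])
    let χ : (n → ℂ[X]) →ₗ[ℂ] ℂ :=
      { toFun := fun v => (Matrix.vecMul v A'.adjugate i0).coeff m
        map_add' := by intro x y; simp [Matrix.add_vecMul]
        map_smul' := by intro x y; simp [Matrix.smul_vecMul] }
    refine ⟨Fin.cons χ φ, fun v hv => ?_⟩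
    have hχ : (Matrix.vecMul v A'.adjugate i0).coeff m = 0 := hv 0
    obtain ⟨w, hw⟩ := hφ v (fun j => hv j.succ)
    have hg' : C (c i0) * g ≠ 0 := by
      intro h
      have := congrArg (eval 0) h
      simp [hi0, hg] at this
    have hw2 : Matrix.vecMul v A'.adjugate = (X ^ m : ℂ[X]) • w := by
      have h3 := congrArg (fun x => Matrix.vecMul x A'.adjugate) hw
      simp only [Matrix.vecMul_vecMul, Matrix.mul_adjugate, Matrix.smul_vecMul, hdet] at h3
      rw [Matrix.vecMul_smul, Matrix.vecMul_one] at h3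
      funext j
      have h4 := congrFun h3 j
      simp only [Pi.smul_apply, smul_eq_mul] at h4 ⊢
      apply mul_left_cancel₀ hg'
      rw [h4]; ring
    have hw0 : X ∣ w i0 := by
      rw [X_dvd_iff]
      rw [hw2] at hχ
      simpa [coeff_X_pow_mul'] using hχ
    obtain ⟨w2, hw2'⟩ := hw0
    have hfin : (C (c i0) * g) • v
        = Matrix.vecMul (fun i => w2 * C (c i) + Function.update w i0 0 i) A := by
      rw [hw]
      funext j
      have e1 : Matrix.vecMul w A' j = w i0 * u' j + Matrix.vecMul (Function.update w i0 0) A j := by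
        simp only [Matrix.vecMul, dotProduct]
        rw [← Finset.add_sum_erase _ _ (Finset.mem_univ i0),
          ← Finset.add_sum_erase _ (fun i => Function.update w i0 0 i * A i j) (Finset.mem_univ i0)]
        simp only [hA', Matrix.updateRow_self, Function.update_self, zero_mul, zero_add]
        congr 1
        apply Finset.sum_congr rfl
        intro i hi
        have : i ≠ i0 := Finset.ne_of_mem_erase hi
        rw [Matrix.updateRow_ne this, Function.update_of_ne this]
      rw [e1, hw2']
      have e2 := hu' j
      simp only [Matrix.vecMul, dotProduct, add_mul, Finset.sum_add_distrib] at e2 ⊢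
      congr 1
      simp only [mul_assoc]
      rw [← Finset.mul_sum, e2]
      ring
    refine ⟨(C (c i0)⁻¹) • (fun i => w2 * C (c i) + Function.update w i0 0 i), ?_⟩
    rw [Matrix.smul_vecMul, ← hfin, smul_smul, ← mul_assoc, ← C_mul, inv_mul_cancel₀ hi0]
    simp

lemma poly_zero_of_small (f : ℂ[X]) (κ : ℕ) (hdeg : f.degree < κ) (B : ℝ)
    (h : ∀ᶠ τ in 𝓝 (0:ℂ), ‖f.eval τ‖ ≤ B * ‖τ‖ ^ κ) : f = 0 := by
  by_contra hf
  obtain ⟨q, hq, hnd⟩ := exists_eq_pow_rootMultiplicity_mul_and_not_dvd f hf 0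
  set k := rootMultiplicity 0 f
  rw [C_0, sub_zero] at hq hnd
  have hq0 : q.eval 0 ≠ 0 := by
    rw [X_dvd_iff, coeff_zero_eq_eval_zero] at hnd
    exact hnd
  have hk : k < κ := by
    have h1 : k ≤ f.natDegree := by
      rw [hq, natDegree_mul (by simp) (by rintro rfl; simp at hq0)]
      simp
    have : f.natDegree < κ := (natDegree_lt_iff_degree_lt hf).mpr hdeg
    omega
  have h2 : ∀ᶠ τ in 𝓝[≠] (0:ℂ), ‖q.eval τ‖ ≤ B * ‖τ‖ ^ (κ - k) := by
    filter_upwards [h.filter_mono nhdsWithin_le_nhds, self_mem_nhdsWithin] with τ hτ hτ0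
    have hpos : 0 < ‖τ‖ ^ k := pow_pos (norm_pos_iff.mpr hτ0) k
    rw [hq] at hτ
    simp only [eval_mul, eval_pow, eval_X, norm_mul, norm_pow] at hτ
    have e : ‖τ‖ ^ κ = ‖τ‖ ^ k * ‖τ‖ ^ (κ - k) := by rw [← pow_add]; congr 1; omega
    rw [e] at hτ
    have : ‖τ‖ ^ k * ‖q.eval τ‖ ≤ ‖τ‖ ^ k * (B * ‖τ‖ ^ (κ - k)) := by linarith
    exact le_of_mul_le_mul_left this hpos
  have h3 : Filter.Tendsto (fun τ : ℂ => ‖q.eval τ‖) (𝓝[≠] 0) (𝓝 ‖q.eval 0‖) :=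
    (q.continuous.norm.tendsto 0).mono_left nhdsWithin_le_nhds
  have h4 : Filter.Tendsto (fun τ : ℂ => B * ‖τ‖ ^ (κ - k)) (𝓝[≠] 0) (𝓝 0) := by
    have : Continuous fun τ : ℂ => B * ‖τ‖ ^ (κ - k) := by fun_prop
    have h5 := this.tendsto 0
    rw [norm_zero, zero_pow (by omega), mul_zero] at h5
    exact h5.mono_left nhdsWithin_le_nhds
  have := le_of_tendsto_of_tendsto h3 h4 h2
  exact hq0 (norm_le_zero_iff.mp this)

lemma coeffs_zero_of_small {t : ℕ} {J S : Type*} [Fintype J] [Fintype S] (D : Fin (t + 1) → ℕ)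
    (hD : ∀ i, 1 ≤ D i) (β : J → Fin (t + 1) → ℕ) (hβ : Function.Injective β) (c : J → ℂ) (κ : ℕ)
    (hlt : ∀ j, ∑ i, D i * β j i < κ) (b : S → Fin (t + 1) → ℕ)
    (hge : ∀ s, κ ≤ ∑ i, D i * b s i) (B : ℝ) (hB : 0 ≤ B)
    (h : ∀ᶠ q in 𝓝 (0 : Fin (t + 1) → ℂ),
      ‖∑ j, c j * ∏ i, q i ^ β j i‖ ≤ B * ∑ s, ∏ i, ‖q i‖ ^ b s i) : c = 0 := by
  have key : ∀ u : Fin (t + 1) → ℂ, ∑ j, c j * ∏ i, u i ^ β j i = 0 := by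
    intro u
    set f : ℂ[X] := ∑ j, C (c j * ∏ i, u i ^ β j i) * X ^ (∑ i, D i * β j i) with hf
    have hf0 : f = 0 := by
      apply poly_zero_of_small f κ _ (B * ∑ s, ∏ i, ‖u i‖ ^ b s i)
      · have hten : Filter.Tendsto (fun τ : ℂ => fun i => τ ^ D i * u i) (𝓝 0)
            (𝓝 (0 : Fin (t + 1) → ℂ)) := by
          have : Continuous (fun τ : ℂ => fun i : Fin (t + 1) => τ ^ D i * u i) := by fun_prop
          have h5 := this.tendsto 0
          convert h5 using 2
          funext i
          simp [zero_pow (Nat.one_le_iff_ne_zero.mp (hD i))]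
        filter_upwards [hten.eventually h, Metric.ball_mem_nhds (0:ℂ) one_pos] with τ hτ hτ1
        have hτ1' : ‖τ‖ ≤ 1 := by simpa using (Metric.mem_ball.mp hτ1).le
        have e1 : f.eval τ = ∑ j, c j * ∏ i, (τ ^ D i * u i) ^ β j i := by
          rw [hf, eval_finsetSum]
          apply Finset.sum_congr rfl
          intro j _
          simp only [eval_mul, eval_C, eval_pow, eval_X, mul_pow, Finset.prod_mul_distrib,
            ← pow_mul, Finset.prod_pow_eq_pow_sum]
          ring
        rw [e1]
        refine hτ.trans ?_
        rw [mul_assoc]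
        apply mul_le_mul_of_nonneg_left _ hB
        rw [Finset.sum_mul]
        apply Finset.sum_le_sum
        intro s _
        simp only [norm_mul, norm_pow, mul_pow, Finset.prod_mul_distrib, ← pow_mul,
          Finset.prod_pow_eq_pow_sum]
        rw [mul_comm]
        apply mul_le_mul_of_nonneg_left
        · exact pow_le_pow_of_le_one (norm_nonneg _) hτ1' (hge s)
        · exact Finset.prod_nonneg fun i _ => by positivity
      · rw [hf]
        rcases Nat.eq_zero_or_pos κ with hk | hk
        · have : IsEmpty J := ⟨fun j => by have := hlt j; omega⟩
          simp
        · rw [← Polynomial.mem_degreeLT]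
          apply Submodule.sum_mem
          intro j _
          rw [Polynomial.mem_degreeLT]
          refine (degree_C_mul_X_pow_le _ _).trans_lt ?_
          exact_mod_cast hlt j
    have := congrArg (eval 1) hf0
    rw [hf, eval_finsetSum] at this
    simp only [eval_mul, eval_C, eval_pow, eval_X, one_pow, mul_one, eval_zero] at this
    exact this
  set P : MvPolynomial (Fin (t + 1)) ℂ :=
    ∑ j, MvPolynomial.monomial (Finsupp.equivFunOnFinite.symm (β j)) (c j) with hP
  have hP0 : P = 0 := by
    apply MvPolynomial.funext
    intro u
    rw [hP, map_sum, map_zero, ← key u]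
    apply Finset.sum_congr rfl
    intro j _
    rw [MvPolynomial.eval_monomial, Finsupp.prod_fintype _ _ (by simp)]
    simp
  funext j
  have := congrArg (MvPolynomial.coeff (Finsupp.equivFunOnFinite.symm (β j))) hP0
  classical
  rw [hP, MvPolynomial.coeff_sum, MvPolynomial.coeff_zero, Finset.sum_eq_single j] at this
  · simpa using this
  · intro j' _ hj'
    rw [MvPolynomial.coeff_monomial, if_neg]
    intro h
    exact hj' (hβ (Finsupp.equivFunOnFinite.symm.injective h))
  · simp
end P3

end WrapP3

section WrapP3b
open scoped BigOperators Topology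

section P3b
open Polynomial

lemma eval2_homog {t N : ℕ} (p : MvPolynomial (Fin (t + 1)) ℂ[X]) (hp : p.IsHomogeneous N)
    (z : ℂ) (x : Fin (t + 1) → ℂ) :
    MvPolynomial.eval₂ (evalRingHom z) x p
      = ∑ s : Col t N, (p.coeff s.1).eval z * ∏ i, x i ^ (s.1 i) := by
  rw [MvPolynomial.eval₂_eq']
  rw [Finset.sum_coe_sort (Finset.finsuppAntidiag Finset.univ N)
    (fun s => (p.coeff s).eval z * ∏ i, x i ^ (s i))]
  apply Finset.sum_subset
  · intro s hs
    rw [mem_col]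
    have := hp (MvPolynomial.mem_support_iff.mp hs)
    rw [Finsupp.degree_eq_weight_one]; exact this
  · intro s _ hs
    rw [MvPolynomial.notMem_support_iff] at hs
    simp [hs]

noncomputable def Qz {t : ℕ} (D : Fin (t + 1) → ℕ) (U : Fin (t + 1) → MvPolynomial (Fin (t + 1)) ℂ)
    (ω : Fin (t + 1) → ℂ) (i : Fin (t + 1)) : MvPolynomial (Fin (t + 1)) ℂ[X] :=
  MvPolynomial.map C (U i) + MvPolynomial.monomial (Finsupp.single 0 (D i)) (X * C (ω i))

lemma Qz_homog {t : ℕ} (D : Fin (t + 1) → ℕ) (U : Fin (t + 1) → MvPolynomial (Fin (t + 1)) ℂ)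
    (hU : ∀ i, (U i).IsHomogeneous (D i)) (ω : Fin (t + 1) → ℂ) (i : Fin (t + 1)) :
    (Qz D U ω i).IsHomogeneous (D i) := by
  apply MvPolynomial.IsHomogeneous.add
  · exact (hU i).map C
  · apply MvPolynomial.isHomogeneous_monomial
    simp

lemma rowP_homog {R : Type*} [CommRing R] {t N : ℕ} (D : Fin (t + 1) → ℕ)
    (Q : Fin (t + 1) → MvPolynomial (Fin (t + 1)) R) (hQ : ∀ i, (Q i).IsHomogeneous (D i))
    (b : Fin (t + 1) → ℕ) (μ : Fin (t + 1) →₀ ℕ) (h : ∑ i, D i * b i + μ.degree = N) :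
    (rowP Q b μ).IsHomogeneous N := by
  subst h
  apply MvPolynomial.IsHomogeneous.mul
  · apply MvPolynomial.IsHomogeneous.prod
    intro i _
    exact (hQ i).pow _
  · exact MvPolynomial.isHomogeneous_monomial _ rfl

lemma eval2_rowP {t : ℕ} (D : Fin (t + 1) → ℕ) (U : Fin (t + 1) → MvPolynomial (Fin (t + 1)) ℂ)
    (ω : Fin (t + 1) → ℂ) (b : Fin (t + 1) → ℕ) (μ : Fin (t + 1) →₀ ℕ) (z : ℂ)
    (x : Fin (t + 1) → ℂ) (hx : x 0 = 1) :
    MvPolynomial.eval₂ (evalRingHom z) x (rowP (Qz D U ω) b μ)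
      = (∏ i, (MvPolynomial.eval x (U i) + z * ω i) ^ b i) * ∏ i, x i ^ μ i := by
  rw [rowP, MvPolynomial.eval₂_mul, MvPolynomial.eval₂_prod]
  congr 1
  · apply Finset.prod_congr rfl
    intro i _
    rw [MvPolynomial.eval₂_pow, Qz, MvPolynomial.eval₂_add, MvPolynomial.eval₂_map,
      MvPolynomial.eval₂_monomial]
    congr 2
    · have : (evalRingHom z).comp C = RingHom.id ℂ := by ext <;> simp
      rw [this, MvPolynomial.eval₂_id]
    · simp [hx]; ring
  · rw [MvPolynomial.eval₂_monomial, Finsupp.prod_fintype _ _ (by simp)]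
    simp

lemma small_transfer {t : ℕ} {J S : Type*} [Fintype J] [Fintype S] (D : Fin (t + 1) → ℕ)
    (hD : ∀ i, 1 ≤ D i) (β : J → Fin (t + 1) → ℕ) (hβ : Function.Injective β) (c : J → ℂ) (κ : ℕ)
    (hlt : ∀ j, ∑ i, D i * β j i < κ) (b : S → Fin (t + 1) → ℕ)
    (hge : ∀ s, κ ≤ ∑ i, D i * b s i)
    (Φ : (Fin (t + 1) → ℂ) → Fin (t + 1) → ℂ) (p0 : Fin (t + 1) → ℂ)
    (hmap : 𝓝 0 ≤ Filter.map Φ (𝓝 p0)) (G : (Fin (t + 1) → ℂ) → ℂ) (hG : Continuous G)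
    (hG0 : G p0 ≠ 0) (W : S → (Fin (t + 1) → ℂ) → ℂ) (hW : ∀ s, Continuous (W s))
    (hid : ∀ p, G p * ∑ j, c j * ∏ i, Φ p i ^ β j i = ∑ s, W s p * ∏ i, Φ p i ^ b s i) :
    c = 0 := by
  set B : ℝ := ∑ s, (‖W s p0‖ + 1) with hB
  have hB0 : 0 ≤ B := Finset.sum_nonneg fun s _ => by positivity
  have hγ : 0 < ‖G p0‖ := norm_pos_iff.mpr hG0
  have ev1 : ∀ᶠ p in 𝓝 p0, ∀ s, ‖W s p‖ ≤ B := by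
    rw [Filter.eventually_all]
    intro s
    have : ‖W s p0‖ < B :=
      lt_of_lt_of_le (lt_add_one _) (Finset.single_le_sum (f := fun s => ‖W s p0‖ + 1)
        (fun s _ => by positivity) (Finset.mem_univ s))
    exact ((hW s).norm.tendsto p0).eventually_le_const this
  have ev2 : ∀ᶠ p in 𝓝 p0, ‖G p0‖ / 2 ≤ ‖G p‖ := by
    apply (hG.norm.tendsto p0).eventually_const_le
    linarith
  refine coeffs_zero_of_small D hD β hβ c κ hlt b hge (2 / ‖G p0‖ * B) (by positivity) (hmap ?_)
  rw [Filter.mem_map]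
  filter_upwards [ev1, ev2] with p hp1 hp2
  have hn := congrArg norm (hid p)
  change ‖∑ j, c j * ∏ i, Φ p i ^ β j i‖ ≤ _ * ∑ s, ∏ i, ‖Φ p i‖ ^ b s i
  rw [norm_mul] at hn
  have hle : ‖G p‖ * ‖∑ j, c j * ∏ i, Φ p i ^ β j i‖ ≤ B * ∑ s, ∏ i, ‖Φ p i‖ ^ b s i := by
    rw [hn, Finset.mul_sum]
    refine (norm_sum_le _ _).trans (Finset.sum_le_sum fun s _ => ?_)
    rw [norm_mul, norm_prod]
    simp only [norm_pow]
    exact mul_le_mul_of_nonneg_right (hp1 s) (Finset.prod_nonneg fun i _ => by positivity)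
  have h5 : ‖G p0‖ / 2 * ‖∑ j, c j * ∏ i, Φ p i ^ β j i‖ ≤ B * ∑ s, ∏ i, ‖Φ p i‖ ^ b s i :=
    (mul_le_mul_of_nonneg_right hp2 (norm_nonneg _)).trans hle
  rw [mul_assoc, div_mul_eq_mul_div, le_div_iff₀ hγ]
  linarith

set_option maxHeartbeats 1000000 in
lemma ord_lemma {t N : ℕ} (D : Fin (t + 1) → ℕ) (hD : ∀ i, 1 ≤ D i)
    (U : Fin (t + 1) → MvPolynomial (Fin (t + 1)) ℂ) (hU : ∀ i, (U i).IsHomogeneous (D i))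
    (ω : Fin (t + 1) → ℂ) (p0 : Fin (t + 1) → ℂ) (hp0 : p0 0 = 0)
    (hmap : 𝓝 0 ≤ Filter.map (fun (p : Fin (t + 1) → ℂ) i =>
      MvPolynomial.eval (Function.update p 0 1) (U i) + p 0 * ω i) (𝓝 p0))
    (b : Col t N → Fin (t + 1) → ℕ) (μ : Col t N → Fin (t + 1) →₀ ℕ)
    (hrow : ∀ s, ∑ i, D i * b s i + (μ s).degree = N) (κ : ℕ)
    (hge : ∀ s, κ ≤ ∑ i, D i * b s i) {J : Type*} [Fintype J] (β : J → Fin (t + 1) → ℕ)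
    (hβ : Function.Injective β) (hlt : ∀ j, ∑ i, D i * β j i < κ) (hκ : κ ≤ N) :
    (X : ℂ[X]) ^ (Fintype.card J) ∣ (rowMat (Qz D U ω) b μ).det := by
  set A := rowMat (Qz D U ω) b μ with hA
  by_cases hdet : A.det = 0
  · rw [hdet]; exact dvd_zero _
  obtain ⟨g, hg, hnd⟩ := exists_eq_pow_rootMultiplicity_mul_and_not_dvd A.det hdet 0
  set m := rootMultiplicity 0 A.det
  rw [C_0, sub_zero] at hg hnd
  have hg0 : g.eval 0 ≠ 0 := by
    rw [X_dvd_iff, coeff_zero_eq_eval_zero] at hnd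
    exact hnd
  by_cases hm : Fintype.card J ≤ m
  · rw [hg]
    exact (pow_dvd_pow _ hm).mul_right _
  exfalso
  push Not at hm
  obtain ⟨φ, hφ⟩ := coker_lemma m A g hg hg0
  let ν : J → (Fin (t + 1) →₀ ℕ) := fun j => Finsupp.single 0 (N - ∑ i, D i * β j i)
  let v : J → Col t N → ℂ[X] := fun j s => (rowP (Qz D U ω) (β j) (ν j)).coeff s.1
  let L : (J → ℂ) →ₗ[ℂ] (Fin m → ℂ) := (LinearMap.pi φ).comp (Fintype.linearCombination ℂ v)
  have hker := LinearMap.ker_ne_bot_of_finrank_lt (f := L) (by simpa using hm)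
  obtain ⟨c, hcL, hc0⟩ := Submodule.exists_mem_ne_zero_of_ne_bot hker
  rw [LinearMap.mem_ker] at hcL
  obtain ⟨w, hw⟩ := hφ (Fintype.linearCombination ℂ v c) (fun j => congrFun hcL j)
  apply hc0
  -- identity
  have hid : ∀ p : Fin (t + 1) → ℂ, g.eval (p 0) * ∑ j, c j * ∏ i,
      (MvPolynomial.eval (Function.update p 0 1) (U i) + p 0 * ω i) ^ β j i
      = ∑ s, (w s).eval (p 0) * ((∏ i, (MvPolynomial.eval (Function.update p 0 1) (U i) + p 0 * ω i) ^ b s i) * ∏ i, (Function.update p 0 1 : Fin (t + 1) → ℂ) i ^ μ s i) := by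
    intro p
    set x : Fin (t + 1) → ℂ := Function.update p 0 1 with hx
    have hx0 : x 0 = 1 := by simp [hx]
    have e1 : ∀ s' : Col t N, g.eval (p 0) * ∑ j, c j * (v j s').eval (p 0)
        = ∑ s, (w s).eval (p 0) * ((rowP (Qz D U ω) (b s) (μ s)).coeff s'.1).eval (p 0) := by
      intro s'
      have := congrArg (eval (p 0)) (congrFun hw s')
      simp only [Pi.smul_apply, smul_eq_mul, eval_mul, Fintype.linearCombination_apply,
        Finset.sum_apply, Matrix.vecMul, dotProduct, eval_finsetSum, eval_smul] at this
      exact this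
    have e2 : ∑ s' : Col t N, (g.eval (p 0) * ∑ j, c j * (v j s').eval (p 0)) * ∏ i, x i ^ s'.1 i
      = ∑ s' : Col t N, (∑ s, (w s).eval (p 0) *
        ((rowP (Qz D U ω) (b s) (μ s)).coeff s'.1).eval (p 0)) * ∏ i, x i ^ s'.1 i := by
      apply Finset.sum_congr rfl
      intro s' _
      rw [e1]
    have e3 : ∀ j, ∏ i, (MvPolynomial.eval x (U i) + p 0 * ω i) ^ β j i
        = ∑ s' : Col t N, (v j s').eval (p 0) * ∏ i, x i ^ s'.1 i := by
      intro j
      rw [← eval2_homog, eval2_rowP _ _ _ _ _ _ _ hx0]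
      · rw [show ∏ i, x i ^ ν j i = 1 from ?_, mul_one]
        apply Finset.prod_eq_one
        intro i _
        by_cases hi : i = 0
        · rw [hi, hx0, one_pow]
        · simp [ν, Ne.symm hi]
      · apply rowP_homog D _ (Qz_homog D U hU ω)
        have := hlt j
        simp only [ν, Finsupp.degree_single]
        omega
    have e4 : ∀ s, (∏ i, (MvPolynomial.eval x (U i) + p 0 * ω i) ^ b s i) * ∏ i, x i ^ μ s i
        = ∑ s' : Col t N, ((rowP (Qz D U ω) (b s) (μ s)).coeff s'.1).eval (p 0)
          * ∏ i, x i ^ s'.1 i := by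
      intro s
      rw [← eval2_homog, eval2_rowP _ _ _ _ _ _ _ hx0]
      exact rowP_homog D _ (Qz_homog D U hU ω) _ _ (hrow s)
    calc _ = ∑ s' : Col t N, (g.eval (p 0) * ∑ j, c j * (v j s').eval (p 0)) * ∏ i, x i ^ s'.1 i := by
          simp_rw [e3, Finset.mul_sum, Finset.sum_mul]
          rw [Finset.sum_comm]
          apply Finset.sum_congr rfl; intro _ _
          apply Finset.sum_congr rfl; intro _ _
          ring
      _ = _ := e2
      _ = _ := by
          simp_rw [e4, Finset.mul_sum, Finset.sum_mul]
          rw [Finset.sum_comm]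
          apply Finset.sum_congr rfl; intro _ _
          apply Finset.sum_congr rfl; intro _ _
          ring
  have h2 : Continuous fun p : Fin (t + 1) → ℂ => (Function.update p 0 1 : Fin (t + 1) → ℂ) :=
    continuous_id.update 0 continuous_const
  refine small_transfer D hD β hβ c κ hlt b hge _ p0 hmap (fun p => g.eval (p 0))
    (g.continuous.comp (continuous_apply 0)) (by rw [hp0]; exact hg0)
    (fun s p => (w s).eval (p 0) * ∏ i, (Function.update p 0 1 : Fin (t + 1) → ℂ) i ^ μ s i) ?_ ?_
  · intro s
    exact ((w s).continuous.comp (continuous_apply 0)).mul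
      (continuous_finsetProd _ fun i _ => ((continuous_apply i).comp h2).pow _)
  · intro p
    rw [hid p]
    apply Finset.sum_congr rfl
    intro s _
    ring
end P3b

end WrapP3b

section WrapP3c
open scoped BigOperators Topology

section P3c
open Polynomial

lemma eventually_injective {t : ℕ} (F : (Fin (t + 1) → ℂ) →L[ℂ] (Fin (t + 1) → ℂ)) :
    ∀ᶠ η in 𝓝[≠] (0 : ℂ), Function.Injective
      ⇑(F + η • ContinuousLinearMap.id ℂ (Fin (t + 1) → ℂ)) := by
  have hfin : Set.Finite {η : ℂ | Module.End.HasEigenvalue (F : Module.End ℂ (Fin (t + 1) → ℂ)) (-η)} := by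
    have := Module.End.finite_hasEigenvalue (F : Module.End ℂ (Fin (t + 1) → ℂ))
    exact this.preimage neg_injective.injOn
  have h2 := (hfin.subset (Set.sdiff_subset (t := {0}))).isClosed.compl_mem_nhds (x := (0:ℂ)) (by simp)
  filter_upwards [mem_nhdsWithin_of_mem_nhds h2, self_mem_nhdsWithin] with η h1 h0
  have hne : ¬ Module.End.HasEigenvalue (F : Module.End ℂ (Fin (t + 1) → ℂ)) (-η) := by
    intro h
    exact h1 ⟨h, h0⟩
  rw [injective_iff_map_eq_zero]
  intro x hx
  by_contra hx0
  apply hne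
  apply Module.End.hasEigenvalue_of_hasEigenvector (x := x)
  refine ⟨?_, hx0⟩
  rw [Module.End.mem_eigenspace_iff]
  simp at hx
  simpa using eq_neg_of_add_eq_zero_left hx

lemma nhds_le_map {t : ℕ} (F : (Fin (t + 1) → ℂ) → (Fin (t + 1) → ℂ)) (p0 : Fin (t + 1) → ℂ)
    (hF : ContDiff ℂ 1 F) (h0 : F p0 = 0) :
    ∀ᶠ η in 𝓝[≠] (0 : ℂ), 𝓝 0 ≤ Filter.map (fun p => F p + η • (p - p0)) (𝓝 p0) := by
  have hs : HasStrictFDerivAt F (fderiv ℂ F p0) p0 :=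
    hF.contDiffAt.hasStrictFDerivAt one_ne_zero
  filter_upwards [eventually_injective (fderiv ℂ F p0)] with η hη
  have h1 : HasStrictFDerivAt (fun p => F p + η • (p - p0))
      (fderiv ℂ F p0 + η • ContinuousLinearMap.id ℂ (Fin (t + 1) → ℂ)) p0 :=
    hs.add (((hasStrictFDerivAt_id p0).sub_const p0).const_smul η)
  let e : (Fin (t + 1) → ℂ) ≃L[ℂ] (Fin (t + 1) → ℂ) :=
    (LinearEquiv.ofInjectiveEndo _ hη).toContinuousLinearEquiv
  have h2 : HasStrictFDerivAt (fun p => F p + η • (p - p0))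
      (e : (Fin (t + 1) → ℂ) →L[ℂ] (Fin (t + 1) → ℂ)) p0 := by
    convert h1 using 1
    ext1 x
    rfl
  have h3 := h2.map_nhds_eq_of_equiv
  rw [h3]
  simp [h0]

lemma det_continuous {t N : ℕ} (Q W : Fin (t + 1) → MvPolynomial (Fin (t + 1)) ℂ)
    (b : Col t N → Fin (t + 1) → ℕ) (μ : Col t N → Fin (t + 1) →₀ ℕ) :
    Continuous fun η : ℂ => (rowMat (fun i => Q i + MvPolynomial.C η * W i) b μ).det := by
  have : ∀ η : ℂ, (rowMat (fun i => Q i + MvPolynomial.C η * W i) b μ).det =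
      (rowMat (fun i => MvPolynomial.map (C : ℂ →+* ℂ[X]) (Q i)
        + MvPolynomial.C X * MvPolynomial.map (C : ℂ →+* ℂ[X]) (W i)) b μ).det.eval η := by
    intro η
    rw [← coe_evalRingHom, ← rowMat_map_det]
    congr 2
    funext i
    have : (evalRingHom η).comp C = RingHom.id ℂ := by ext; simp
    simp [MvPolynomial.map_map, this, MvPolynomial.map_id]
  simp_rw [this]
  exact Polynomial.continuous _

lemma l1_neg {t : ℕ} (p : MvPolynomial (Fin (t + 1)) ℂ) : l1 (-p) = l1 p := by
  simp [l1]

lemma l1_C {t : ℕ} (c : ℂ) : l1 (MvPolynomial.C c : MvPolynomial (Fin (t + 1)) ℂ) = ‖c‖ := by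
  rw [MvPolynomial.C_apply, l1_monomial]

lemma det_small {t N : ℕ} (D : Fin (t + 1) → ℕ) (hD : ∀ i, 1 ≤ D i)
    (Q : Fin (t + 1) → MvPolynomial (Fin (t + 1)) ℂ) (hQ : ∀ i, (Q i).IsHomogeneous (D i))
    (ξ : Fin t → ℂ) (ε : ℝ) (hε0 : 0 < ε) (hε1 : ε < 1) (M : Fin (t + 1) → ℝ)
    (hM : ∀ i, ‖MvPolynomial.eval (Fin.cons 1 ξ) (Q i)‖ ≤ ε * M i)
    (b : Col t N → Fin (t + 1) → ℕ) (μ : Col t N → Fin (t + 1) →₀ ℕ)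
    (hrow : ∀ s, ∑ i, D i * b s i + (μ s).degree = N) (κ : ℕ)
    (hge : ∀ s, κ ≤ ∑ i, D i * b s i) {J : Type*} [Fintype J] (β : J → Fin (t + 1) → ℕ)
    (hβ : Function.Injective β) (hlt : ∀ j, ∑ i, D i * β j i < κ) (hκ : κ ≤ N) :
    ‖(rowMat Q b μ).det‖ ≤ ε ^ (Fintype.card J) * ∏ i, (l1 (Q i) + 2 * M i) ^ (∑ s, b s i) := by
  set δ : Fin (t + 1) → ℂ := fun i => MvPolynomial.eval (Fin.cons 1 ξ) (Q i) with hδ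
  set p0 : Fin (t + 1) → ℂ := Fin.cons 0 ξ with hp0
  set V : Fin (t + 1) → MvPolynomial (Fin (t + 1)) ℂ := fun i =>
    if i = 0 then 0 else (MvPolynomial.X i - MvPolynomial.C (p0 i) * MvPolynomial.X 0)
      * MvPolynomial.X 0 ^ (D i - 1) with hV
  set o : Fin (t + 1) → ℂ := fun i => if i = 0 then 1 else 0 with ho
  set U : ℂ → Fin (t + 1) → MvPolynomial (Fin (t + 1)) ℂ := fun η i =>
    Q i - MvPolynomial.monomial (Finsupp.single 0 (D i)) (δ i) + MvPolynomial.C η * V i with hU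
  set ω : ℂ → Fin (t + 1) → ℂ := fun η i => δ i + η * o i with hω
  set W : Fin (t + 1) → MvPolynomial (Fin (t + 1)) ℂ := fun i =>
    V i + MvPolynomial.monomial (Finsupp.single 0 (D i)) (o i) with hW
  have hVh : ∀ i, (V i).IsHomogeneous (D i) := by
    intro i
    simp only [hV]
    split_ifs with hi
    · exact MvPolynomial.isHomogeneous_zero _ _ _
    · have : D i = 1 + (D i - 1) := by have := hD i; omega
      conv => arg 2; rw [this]
      apply MvPolynomial.IsHomogeneous.mul
      · apply MvPolynomial.IsHomogeneous.sub
        · exact MvPolynomial.isHomogeneous_X _ _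
        · have := (MvPolynomial.isHomogeneous_C (Fin (t + 1)) (p0 i)).mul
            (MvPolynomial.isHomogeneous_X ℂ (0 : Fin (t + 1)))
          simpa using this
      · exact MvPolynomial.isHomogeneous_X_pow _ _
  have hUh : ∀ η i, (U η i).IsHomogeneous (D i) := by
    intro η i
    apply MvPolynomial.IsHomogeneous.add
    · apply (hQ i).sub
      apply MvPolynomial.isHomogeneous_monomial
      simp
    · have := (MvPolynomial.isHomogeneous_C (Fin (t + 1)) η).mul (hVh i)
      simpa using this
  set F : (Fin (t + 1) → ℂ) → (Fin (t + 1) → ℂ) := fun p i =>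
    MvPolynomial.eval (Function.update p 0 1) (Q i) - δ i + p 0 * δ i with hF
  have hupd : ContDiff ℂ 1 fun p : Fin (t + 1) → ℂ => (Function.update p 0 1 : Fin (t + 1) → ℂ) := by
    rw [contDiff_pi]
    intro i
    by_cases hi : i = 0
    · subst hi; simp only [Function.update_self]; exact contDiff_const
    · simp only [Function.update_of_ne hi]; exact contDiff_apply _ _ _
  have hFc : ContDiff ℂ 1 F := by
    rw [contDiff_pi]
    intro i
    have h1 : ContDiff ℂ 1 fun p : Fin (t + 1) → ℂ => MvPolynomial.eval (Function.update p 0 1) (Q i) := by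
      have h2 : ∀ p : Fin (t + 1) → ℂ, MvPolynomial.eval (Function.update p 0 1) (Q i)
          = ∑ m ∈ (Q i).support, (Q i).coeff m * ∏ j, (Function.update p 0 1 : Fin (t + 1) → ℂ) j ^ m j :=
        fun p => MvPolynomial.eval_eq' _ _
      simp_rw [h2]
      apply ContDiff.sum
      intro m _
      apply contDiff_const.mul
      apply contDiff_prod
      intro j _
      exact ((contDiff_pi.mp hupd) j).pow _
    exact (h1.sub contDiff_const).add ((contDiff_apply _ _ _).mul contDiff_const)
  have hu0 : (Function.update p0 0 1 : Fin (t + 1) → ℂ) = Fin.cons 1 ξ := by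
    rw [hp0, Fin.update_cons_zero]
  have hF0 : F p0 = 0 := by
    funext i
    simp only [hF, hu0, Pi.zero_apply]
    simp [hδ, hp0]
  have hΦ : ∀ η, (fun (p : Fin (t + 1) → ℂ) i =>
      MvPolynomial.eval (Function.update p 0 1) (U η i) + p 0 * ω η i)
      = fun p => F p + η • (p - p0) := by
    intro η
    funext p i
    simp only [hU, hω, hF, hV, ho, Pi.add_apply, Pi.smul_apply, Pi.sub_apply, smul_eq_mul]
    by_cases hi : i = 0
    · subst hi
      simp [hp0, MvPolynomial.eval_monomial]
      ring
    · simp [hi, MvPolynomial.eval_monomial]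
      ring
  have hmain : ∀ᶠ η in 𝓝[≠] (0:ℂ), ‖(rowMat (fun i => Q i + MvPolynomial.C η * W i) b μ).det‖
      ≤ ε ^ (Fintype.card J) * ∏ i, (l1 (Q i) + 2 * M i + ‖η‖ * (l1 (V i) + ε⁻¹)) ^ (∑ s, b s i) := by
    filter_upwards [nhds_le_map F p0 hFc hF0] with η hη
    rw [← hΦ η] at hη
    have hdvd := ord_lemma D hD (U η) (hUh η) (ω η) p0 (by simp [hp0]) hη b μ hrow κ hge β hβ hlt hκ
    have hev : ∀ z, (rowMat (Qz D (U η) (ω η)) b μ).det.eval z =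
        (rowMat (fun i => U η i + MvPolynomial.monomial (Finsupp.single 0 (D i)) (z * ω η i)) b μ).det := by
      intro z
      rw [← coe_evalRingHom, ← rowMat_map_det]
      congr 2
      funext i
      have : (evalRingHom z).comp C = RingHom.id ℂ := by ext; simp
      simp [Qz, MvPolynomial.map_map, this, MvPolynomial.map_id]
      rw [mul_comm]
    have hsch := schwarz_poly _ _ hdvd ε
      (∏ i, (l1 (Q i) + 2 * M i + ‖η‖ * (l1 (V i) + ε⁻¹)) ^ (∑ s, b s i)) hε0 hε1 ?_
    · rw [hev] at hsch
      convert hsch using 4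
      funext i
      simp only [hU, hω, hW, one_mul]
      rw [mul_add, MvPolynomial.C_mul_monomial, map_add]
      ring
    · intro z hz
      rw [hev]
      apply norm_rowMat_det_le
      intro i
      have ho1 : ‖o i‖ ≤ 1 := by simp only [ho]; split_ifs <;> simp
      have hωn : ‖ω η i‖ ≤ ε * M i + ‖η‖ := by
        refine (norm_add_le _ _).trans ?_
        rw [norm_mul]
        have := mul_le_of_le_one_right (norm_nonneg η) ho1
        linarith [hM i]
      have hM0 : 0 ≤ M i := by
        by_contra hneg
        have := (norm_nonneg _).trans (hM i)
        have := mul_neg_of_pos_of_neg hε0 (not_le.mp hneg)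
        linarith
      have a1 : l1 (t := t) (MvPolynomial.monomial (Finsupp.single 0 (D i)) (z * ω η i))
          ≤ M i + ‖η‖ * ε⁻¹ := by
        rw [l1_monomial, norm_mul, hz]
        calc ε⁻¹ * ‖ω η i‖ ≤ ε⁻¹ * (ε * M i + ‖η‖) := by gcongr
          _ = _ := by field_simp
      have a2 : l1 (U η i) ≤ l1 (Q i) + M i + ‖η‖ * l1 (V i) := by
        refine (l1_add _ _).trans (add_le_add ?_ ?_)
        · rw [sub_eq_add_neg]
          refine (l1_add _ _).trans (add_le_add le_rfl ?_)
          rw [l1_neg, l1_monomial]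
          exact (hM i).trans (mul_le_of_le_one_left hM0 hε1.le)
        · refine (l1_mul _ _).trans ?_
          rw [l1_C]
      have := l1_add (U η i) (MvPolynomial.monomial (Finsupp.single 0 (D i)) (z * ω η i))
      linarith
  have hl := ((det_continuous Q W b μ).norm.tendsto 0).mono_left
    (nhdsWithin_le_nhds (a := (0:ℂ)) (s := {0}ᶜ))
  have hrc : Continuous fun η : ℂ => ε ^ (Fintype.card J) * ∏ i, (l1 (Q i) + 2 * M i + ‖η‖ * (l1 (V i) + ε⁻¹)) ^ (∑ s, b s i) := by
    fun_prop
  have hr := (hrc.tendsto 0).mono_left (nhdsWithin_le_nhds (a := (0:ℂ)) (s := {0}ᶜ))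
  have := le_of_tendsto_of_tendsto hl hr hmain
  simpa using this
end P3c

end WrapP3c

section WrapP3d
open scoped BigOperators Topology

section P3d

def mm {t : ℕ} (D : Fin (t + 1) → ℕ) (i : Fin (t + 1)) : ℕ := ∏ j ∈ Finset.univ.erase i, D j

lemma D_mul_mm {t : ℕ} (D : Fin (t + 1) → ℕ) (i : Fin (t + 1)) : D i * mm D i = ∏ j, D j :=
  Finset.mul_prod_erase _ _ (Finset.mem_univ i)

lemma prod_mm {t : ℕ} (D : Fin (t + 1) → ℕ) (hD : ∀ i, 1 ≤ D i) :
    ∏ i, mm D i = (∏ j, D j) ^ t := by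
  have h1 : ∏ i, (D i * mm D i) = (∏ j, D j) ^ (t + 1) := by
    simp [D_mul_mm]
  rw [Finset.prod_mul_distrib, pow_succ'] at h1
  exact Nat.eq_of_mul_eq_mul_left (Finset.prod_pos fun i _ => hD i) h1

lemma exists_index {t : ℕ} (D : Fin (t + 1) → ℕ) (hD : ∀ i, 1 ≤ D i) (k : ℕ) (hk : t + 1 ≤ k) :
    ∃ (J : Type) (_ : Fintype J) (β : J → Fin (t + 1) → ℕ), Function.Injective β ∧
      (∀ j, ∑ i, D i * β j i < (∏ j, D j) * k) ∧
      Fintype.card J = (∏ j, D j) ^ t * k.choose (t + 1) := by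
  obtain ⟨A, rfl⟩ := Nat.exists_eq_add_of_le' hk
  refine ⟨Col (t + 1) A × (∀ i : Fin (t + 1), Fin (mm D i)), inferInstance,
    fun x i => mm D i * x.1.1 i.succ + x.2 i, ?_, ?_, ?_⟩
  · rintro ⟨s, f⟩ ⟨s', f'⟩ h
    have h1 : ∀ i : Fin (t + 1), mm D i * s.1 i.succ + f i = mm D i * s'.1 i.succ + f' i := fun i => congrFun h i
    have h2 : ∀ i : Fin (t + 1), s.1 i.succ = s'.1 i.succ := by
      intro i
      have hpos : 0 < mm D i := Finset.prod_pos fun j _ => hD j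
      have := congrArg (· / mm D i) (h1 i)
      simpa [Nat.mul_add_div hpos, Nat.div_eq_of_lt (f i).2, Nat.div_eq_of_lt (f' i).2] using this
    have h3 : ∀ i, f i = f' i := by
      intro i
      have := h1 i
      rw [h2 i] at this
      exact Fin.ext (by omega)
    have hs := mem_col.mp s.2
    have hs' := mem_col.mp s'.2
    rw [Finsupp.degree_eq_sum, Fin.sum_univ_succ] at hs hs'
    simp only [h2] at hs
    have h0 : s.1 0 = s'.1 0 := by omega
    refine Prod.ext (Subtype.ext (Finsupp.ext fun i => ?_)) (funext h3)
    refine Fin.cases h0 h2 i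
  · rintro ⟨s, f⟩
    have hs := mem_col.mp s.2
    rw [Finsupp.degree_eq_sum, Fin.sum_univ_succ] at hs
    have h1 : ∑ i : Fin (t + 1), D i * (mm D i * s.1 i.succ + f i)
        = (∏ j, D j) * ∑ i : Fin (t + 1), s.1 i.succ + ∑ i, D i * (f i : ℕ) := by
      rw [Finset.mul_sum, ← Finset.sum_add_distrib]
      apply Finset.sum_congr rfl
      intro i _
      rw [← D_mul_mm D i]; ring
    have h2 : ∑ i : Fin (t + 1), D i * (f i : ℕ) < ∑ i : Fin (t + 1), ∏ j, D j := by
      apply Finset.sum_lt_sum_of_nonempty Finset.univ_nonempty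
      intro i _
      rw [← D_mul_mm D i]
      exact Nat.mul_lt_mul_of_pos_left (f i).2 (hD i)
    have h3 : ∑ i : Fin (t + 1), ∏ j, D j = (∏ j, D j) * (t + 1) := by
      simp [mul_comm]
    change ∑ i : Fin (t + 1), D i * (mm D i * s.1 i.succ + f i) < _
    rw [h1]
    have h4 : (∏ j, D j) * ∑ i : Fin (t + 1), s.1 i.succ ≤ (∏ j, D j) * A :=
      Nat.mul_le_mul_left _ (by omega)
    rw [Nat.mul_add]
    omega
  · rw [Fintype.card_prod, card_col, Fintype.card_pi]
    simp only [Fintype.card_fin]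
    rw [prod_mm D hD, mul_comm]

lemma det_small' {t n k : ℕ} (D : Fin (t + 1) → ℕ) (hD : ∀ i, 1 ≤ D i)
    (Q : Fin (t + 1) → MvPolynomial (Fin (t + 1)) ℂ) (hQ : ∀ i, (Q i).IsHomogeneous (D i))
    (ξ : Fin t → ℂ) (ε : ℝ) (hε0 : 0 < ε) (hε1 : ε < 1) (M : Fin (t + 1) → ℝ)
    (hM : ∀ i, ‖MvPolynomial.eval (Fin.cons 1 ξ) (Q i)‖ ≤ ε * M i)
    (a : Col t ((∏ j, D j) * n) → Fin (t + 1) → ℕ) (μ : Col t ((∏ j, D j) * n) → Fin (t + 1) →₀ ℕ)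
    (hrow : ∀ s, (∏ j, D j) * ∑ i, a s i + (μ s).degree = (∏ j, D j) * n)
    (hge : ∀ s, k ≤ ∑ i, a s i) (hk : t + 1 ≤ k) (hkn : k ≤ n) :
    ‖(rowMat Q (fun s i => mm D i * a s i) μ).det‖ ≤
      ε ^ ((∏ j, D j) ^ t * k.choose (t + 1)) *
        ∏ i, (l1 (Q i) + 2 * M i) ^ (mm D i * ∑ s, a s i) := by
  obtain ⟨J, _, β, hβ, hlt, hcard⟩ := exists_index D hD k hk
  have hsum : ∀ s, ∑ i, D i * (mm D i * a s i) = (∏ j, D j) * ∑ i, a s i := by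
    intro s
    rw [Finset.mul_sum]
    apply Finset.sum_congr rfl
    intro i _
    rw [← D_mul_mm D i]; ring
  have := det_small D hD Q hQ ξ ε hε0 hε1 M hM (fun s i => mm D i * a s i) μ
    (fun s => by rw [hsum]; exact hrow s) ((∏ j, D j) * k)
    (fun s => by rw [hsum]; exact Nat.mul_le_mul_left _ (hge s)) β hβ hlt
    (Nat.mul_le_mul_left _ hkn)
  rw [hcard] at this
  simpa only [Finset.mul_sum] using this
end P3d

end WrapP3d

section WrapP4a
open scoped BigOperators

section P4a
open MvPolynomial

variable {F : Type*} [Field F] {t : ℕ}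

lemma hc_mul (E m : ℕ) (c p : MvPolynomial (Fin (t + 1)) F) (hp : p.IsHomogeneous E) :
    homogeneousComponent (m + E) (c * p) = homogeneousComponent m c * p := by
  conv_lhs => rw [← sum_homogeneousComponent c]
  rw [Finset.sum_mul, map_sum]
  have h1 : ∀ j, homogeneousComponent (m + E) (homogeneousComponent j c * p)
      = if j = m then homogeneousComponent m c * p else 0 := by
    intro j
    have hh : homogeneousComponent j c * p ∈ homogeneousSubmodule (Fin (t + 1)) F (j + E) :=
      (homogeneousComponent_isHomogeneous j c).mul hp
    rw [homogeneousComponent_of_mem hh]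
    by_cases hj : j = m
    · subst hj; simp
    · rw [if_neg (by omega), if_neg hj]
  simp only [h1]
  rw [Finset.sum_ite_eq']
  split_ifs with h
  · rfl
  · rw [homogeneousComponent_eq_zero, zero_mul]
    simpa using h

def GG (t E k0 : ℕ) : Finset (Fin (t + 1) →₀ ℕ) :=
  (Finset.range (k0 + 1)).biUnion fun k => Finset.finsuppAntidiag Finset.univ (E * k)

lemma mem_GG {E k0 : ℕ} {μ : Fin (t + 1) →₀ ℕ} : μ ∈ GG t E k0 ↔ ∃ k ≤ k0, μ.degree = E * k := by
  simp only [GG, Finset.mem_biUnion, mem_col, Finset.mem_range, Nat.lt_succ_iff]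

def RR (t E n : ℕ) (G : Finset (Fin (t + 1) →₀ ℕ)) : Set ((Fin (t + 1) →₀ ℕ) × (Fin (t + 1) →₀ ℕ)) :=
  {x | E * x.1.degree + x.2.degree = E * n ∧ x.2 ∈ G}

noncomputable def rv (P : Fin (t + 1) → MvPolynomial (Fin (t + 1)) F)
    (x : (Fin (t + 1) →₀ ℕ) × (Fin (t + 1) →₀ ℕ)) : MvPolynomial (Fin (t + 1)) F :=
  rowP P x.1 x.2

lemma rv_homog {E : ℕ} (P : Fin (t + 1) → MvPolynomial (Fin (t + 1)) F)
    (hP : ∀ i, (P i).IsHomogeneous E) (x) : (rv P x).IsHomogeneous (E * x.1.degree + x.2.degree) := by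
  apply rowP_homog (fun _ => E) P hP
  rw [Finsupp.degree_eq_sum x.1, Finset.mul_sum]

lemma mul_rv (P : Fin (t + 1) → MvPolynomial (Fin (t + 1)) F) (i : Fin (t + 1)) (x) :
    P i * rv P x = rv P (x.1 + Finsupp.single i 1, x.2) := by
  simp only [rv, rowP, ← mul_assoc]
  congr 1
  simp only [Finsupp.add_apply, pow_add, Finset.prod_mul_distrib]
  rw [mul_comm]
  congr 1
  rw [Finset.prod_eq_single i]
  · simp
  · intro j _ hj
    simp [Finsupp.single_apply, Ne.symm hj]
  · simp

lemma homog_mem_span_monomials {N : ℕ} (p : MvPolynomial (Fin (t + 1)) F) (hp : p.IsHomogeneous N)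
    (W : Submodule F (MvPolynomial (Fin (t + 1)) F))
    (hW : ∀ ν : Fin (t + 1) →₀ ℕ, ν.degree = N → monomial ν 1 ∈ W) : p ∈ W := by
  rw [p.as_sum]
  apply Submodule.sum_mem
  intro ν hν
  rw [← mul_one (coeff ν p), ← smul_eq_mul, ← smul_monomial]
  apply W.smul_mem
  apply hW
  have := hp (mem_support_iff.mp hν)
  rw [Finsupp.degree_eq_weight_one]; exact this

lemma exists_span {E : ℕ} (hE : 1 ≤ E) (P : Fin (t + 1) → MvPolynomial (Fin (t + 1)) F)
    (hP : ∀ i, (P i).IsHomogeneous E)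
    (hnull : ∀ j, ∃ k, (X j : MvPolynomial (Fin (t + 1)) F) ^ k ∈ Ideal.span (Set.range P)) :
    ∃ k0, ∀ n, ∀ p : MvPolynomial (Fin (t + 1)) F, p.IsHomogeneous (E * n) →
      p ∈ Submodule.span F (rv P '' RR t E n (GG t E k0)) := by
  choose k hk using hnull
  refine ⟨∑ j, k j, fun n => ?_⟩
  set k0 := ∑ j, k j
  induction n with
  | zero =>
    intro p hp
    apply homog_mem_span_monomials p hp
    intro ν hν
    apply Submodule.subset_span
    refine ⟨(0, ν), ⟨by simpa using hν, mem_GG.mpr ⟨0, by omega, hν⟩⟩, ?_⟩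
    simp [rv, rowP]
  | succ n ih =>
    intro p hp
    apply homog_mem_span_monomials p hp
    intro ν hν
    by_cases hn : n + 1 ≤ k0
    · apply Submodule.subset_span
      refine ⟨(0, ν), ⟨by simpa using hν, mem_GG.mpr ⟨n + 1, hn, hν⟩⟩, ?_⟩
      simp [rv, rowP]
    · obtain ⟨j, hj⟩ : ∃ j, k j ≤ ν j := by
        by_contra hcon
        push Not at hcon
        have h1 : ν.degree ≤ k0 := by
          rw [Finsupp.degree_eq_sum]
          exact Finset.sum_le_sum fun j _ => (hcon j).le
        have : n + 1 ≤ E * (n + 1) := Nat.le_mul_of_pos_left _ hE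
        omega
      have hmem : monomial ν (1 : F) ∈ Ideal.span (Set.range P) := by
        have : monomial ν (1 : F) = monomial (ν - Finsupp.single j (k j)) 1 * X j ^ (k j) := by
          rw [X_pow_eq_monomial, monomial_mul, one_mul, tsub_add_cancel_of_le]
          simpa using hj
        rw [this]
        exact Ideal.mul_mem_left _ _ (hk j)
      obtain ⟨c, hc⟩ := (Ideal.mem_span_range_iff_exists_fun).mp hmem
      have hmon : homogeneousComponent (E * (n + 1)) (monomial ν (1 : F)) = monomial ν 1 :=
        homogeneousComponent_eq_self (isHomogeneous_monomial _ hν)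
      rw [← hmon, ← hc, map_sum]
      apply Submodule.sum_mem
      intro i _
      rw [Nat.mul_succ, hc_mul E _ _ _ (hP i), mul_comm]
      have h2 := ih _ (homogeneousComponent_isHomogeneous (E * n) (c i))
      have h3 := Submodule.mem_map_of_mem (f := LinearMap.mulLeft F (P i)) h2
      rw [Submodule.map_span] at h3
      refine Submodule.span_mono ?_ h3
      rintro _ ⟨_, ⟨x, ⟨hx1, hx2⟩, rfl⟩, rfl⟩
      refine ⟨(x.1 + Finsupp.single i 1, x.2), ⟨?_, hx2⟩, ?_⟩
      · simp only [map_add, Finsupp.degree_single]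
        nlinarith
      · rw [LinearMap.mulLeft_apply, mul_rv]
end P4a

end WrapP4a

section WrapP4b
open scoped BigOperators

section P4b
open MvPolynomial

variable {F : Type} [Field F] {t : ℕ}

lemma prodP_mem (P : Fin (t + 1) → MvPolynomial (Fin (t + 1)) F) (a : Fin (t + 1) → ℕ) :
    ∏ i, P i ^ a i ∈ Algebra.adjoin F (Set.range P) :=
  Subalgebra.prod_mem _ fun i _ => Subalgebra.pow_mem _ (Algebra.subset_adjoin (Set.mem_range_self i)) _

lemma rv_mem_span (P : Fin (t + 1) → MvPolynomial (Fin (t + 1)) F)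
    (B : Set (Fin (t + 1) →₀ ℕ)) (x) (hx : x.2 ∈ B) :
    rv P x ∈ Submodule.span (Algebra.adjoin F (Set.range P))
      ((fun μ => monomial μ (1 : F)) '' B) := by
  have : rv P x = (⟨_, prodP_mem P x.1⟩ : Algebra.adjoin F (Set.range P)) • monomial x.2 (1 : F) := by
    rw [Subalgebra.smul_def]; rfl
  rw [this]
  exact Submodule.smul_mem _ _ (Submodule.subset_span ⟨_, hx, rfl⟩)

lemma homog_mem_spanA {E k0 n : ℕ} (P : Fin (t + 1) → MvPolynomial (Fin (t + 1)) F)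
    (p : MvPolynomial (Fin (t + 1)) F)
    (h : p ∈ Submodule.span F (rv P '' RR t E n (GG t E k0))) :
    p ∈ Submodule.span (Algebra.adjoin F (Set.range P))
      ((fun μ => monomial μ (1 : F)) '' (GG t E k0 : Set (Fin (t + 1) →₀ ℕ))) := by
  have : Submodule.span F (rv P '' RR t E n (GG t E k0)) ≤
      (Submodule.span (Algebra.adjoin F (Set.range P))
      ((fun μ => monomial μ (1 : F)) '' (GG t E k0 : Set (Fin (t + 1) →₀ ℕ)))).restrictScalars F := by
    rw [Submodule.span_le]
    rintro _ ⟨x, hx, rfl⟩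
    exact rv_mem_span P _ x hx.2
  exact this h

lemma algInd {E k0 : ℕ} (hE : 1 ≤ E) (P : Fin (t + 1) → MvPolynomial (Fin (t + 1)) F)
    (hsp : ∀ n, ∀ p : MvPolynomial (Fin (t + 1)) F, p.IsHomogeneous (E * n) →
      p ∈ Submodule.span F (rv P '' RR t E n (GG t E k0))) :
    AlgebraicIndependent F P := by
  set A := Algebra.adjoin F (Set.range P) with hA
  set N := Submodule.span A ((fun μ => monomial μ (1 : F)) '' (GG t E k0 : Set (Fin (t + 1) →₀ ℕ))) with hN
  have hint : ∀ j, IsIntegral A (X j : MvPolynomial (Fin (t + 1)) F) := by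
    intro j
    have h1 : IsIntegral A ((X j : MvPolynomial (Fin (t + 1)) F) ^ E) := by
      refine isIntegral_of_smul_mem_submodule N ?_ ?_ _ ?_
      · rw [Submodule.ne_bot_iff]
        refine ⟨monomial 0 1, Submodule.subset_span ⟨0, ?_, rfl⟩, by simp⟩
        exact mem_GG.mpr ⟨0, by omega, by simp⟩
      · exact Submodule.fg_span ((GG t E k0).finite_toSet.image _)
      · intro p hp
        induction hp using Submodule.span_induction with
        | mem p hp =>
          obtain ⟨μ, hμ, rfl⟩ := hp
          obtain ⟨k, hk, hd⟩ := mem_GG.mp hμ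
          apply homog_mem_spanA (n := k + 1)
          apply hsp
          rw [smul_eq_mul, mul_add, mul_one, add_comm (E * k) E]
          exact (isHomogeneous_X_pow j E).mul (isHomogeneous_monomial _ hd)
        | zero => simp
        | add x y _ _ hx hy => rw [smul_add]; exact N.add_mem hx hy
        | smul a x _ hx => rw [smul_comm]; exact N.smul_mem _ hx
    exact h1.of_pow hE
  have : Algebra.IsIntegral A (MvPolynomial (Fin (t + 1)) F) := by
    constructor
    intro p
    induction p using MvPolynomial.induction_on with
    | C a =>
      have : (C a : MvPolynomial (Fin (t + 1)) F) = algebraMap A _ (algebraMap F A a) := rfl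
      rw [this]; exact isIntegral_algebraMap
    | add p q hp hq => exact hp.add hq
    | mul_X p j hp => exact hp.mul (hint j)
  have : Algebra.IsAlgebraic A (MvPolynomial (Fin (t + 1)) F) := inferInstance
  have := Algebra.IsAlgebraic.isTranscendenceBasis_of_le_trdeg_of_finite F P (by
    rw [MvPolynomial.trdeg_of_isDomain]; simp)
  exact this.1
end P4b

end WrapP4b

section WrapP4c
open scoped BigOperators

section P4c
open MvPolynomial

variable {F : Type} [Field F] {t : ℕ}

lemma li_rv (P : Fin (t + 1) → MvPolynomial (Fin (t + 1)) F) (hP : AlgebraicIndependent F P)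
    (B : Finset (Fin (t + 1) →₀ ℕ))
    (hB : LinearIndepOn (Algebra.adjoin F (Set.range P)) (fun μ => monomial μ (1 : F))
      (B : Set (Fin (t + 1) →₀ ℕ))) :
    LinearIndepOn F (rv P) {x | x.2 ∈ B} := by
  set A := Algebra.adjoin F (Set.range P) with hA
  have h1 : LinearIndependent F (fun a : Fin (t + 1) →₀ ℕ => (⟨_, prodP_mem P a⟩ : A)) := by
    apply LinearIndependent.of_comp A.val.toLinearMap
    have h2 := (basisMonomials (Fin (t + 1)) F).linearIndependent.map' (aeval P).toLinearMap
      (LinearMap.ker_eq_bot.mpr hP)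
    have h5 : (A.val.toLinearMap ∘ fun a : Fin (t + 1) →₀ ℕ => (⟨_, prodP_mem P a⟩ : A))
        = ((aeval P).toLinearMap ∘ (basisMonomials (Fin (t + 1)) F)) := by
      funext a
      simp only [Function.comp_apply, coe_basisMonomials, AlgHom.toLinearMap_apply, aeval_monomial]
      rw [Finsupp.prod_fintype _ _ (by simp)]
      simp
    rw [h5]
    exact h2
  have h3 := linearIndependent_smul h1 hB
  have h4 := h3.comp (fun x : {x : (Fin (t + 1) →₀ ℕ) × (Fin (t + 1) →₀ ℕ) | x.2 ∈ B} =>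
    (x.1.1, (⟨x.1.2, x.2⟩ : (B : Set (Fin (t + 1) →₀ ℕ))))) (by
      intro x y hxy
      simp only [Prod.mk.injEq, Subtype.mk.injEq] at hxy
      exact Subtype.ext (Prod.ext hxy.1 hxy.2))
  exact h4

lemma exists_maxB (P : Fin (t + 1) → MvPolynomial (Fin (t + 1)) F)
    (G : Finset (Fin (t + 1) →₀ ℕ)) :
    ∃ B ⊆ G, LinearIndepOn (Algebra.adjoin F (Set.range P)) (fun μ => monomial μ (1 : F))
        (B : Set (Fin (t + 1) →₀ ℕ)) ∧
      ∃ h : Algebra.adjoin F (Set.range P), h ≠ 0 ∧ ∀ μ ∈ G, h • monomial μ (1 : F) ∈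
        Submodule.span (Algebra.adjoin F (Set.range P))
          ((fun μ => monomial μ (1 : F)) '' (B : Set (Fin (t + 1) →₀ ℕ))) := by
  classical
  set A := Algebra.adjoin F (Set.range P) with hA
  set v : (Fin (t + 1) →₀ ℕ) → MvPolynomial (Fin (t + 1)) F := fun μ => monomial μ (1 : F) with hv
  obtain ⟨B, hB, hmax⟩ := Finset.exists_max_image
    (G.powerset.filter fun B : Finset (Fin (t + 1) →₀ ℕ) => LinearIndepOn A v (B : Set (Fin (t + 1) →₀ ℕ))) Finset.card
    ⟨∅, by simp [linearIndepOn_empty]⟩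
  simp only [Finset.mem_filter, Finset.mem_powerset] at hB hmax
  refine ⟨B, hB.1, hB.2, ?_⟩
  have key : ∀ μ : Fin (t + 1) →₀ ℕ, ∃ h : A, h ≠ 0 ∧ (μ ∈ G → h • v μ ∈ Submodule.span A (v '' B)) := by
    intro μ
    by_cases hμG : μ ∈ G
    swap
    · exact ⟨1, one_ne_zero, fun h => absurd h hμG⟩
    by_cases hμ : μ ∈ B
    · exact ⟨1, one_ne_zero, fun _ => by
        rw [one_smul]; exact Submodule.subset_span ⟨μ, hμ, rfl⟩⟩
    have hn : ¬ LinearIndepOn A v ((insert μ B : Finset _) : Set (Fin (t + 1) →₀ ℕ)) := by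
      intro hli
      have := hmax (insert μ B) ⟨Finset.insert_subset hμG hB.1, hli⟩
      rw [Finset.card_insert_of_notMem hμ] at this
      omega
    obtain ⟨f, hf, i, hi, hfi⟩ := not_linearIndepOn_finset_iff.mp hn
    rw [Finset.sum_insert hμ] at hf
    refine ⟨f μ, ?_, fun _ => ?_⟩
    · intro h0
      rw [h0, zero_smul, zero_add] at hf
      have := linearIndepOn_finset_iff.mp hB.2 f hf
      rcases Finset.mem_insert.mp hi with rfl | hi
      · exact hfi h0
      · exact hfi (this i hi)
    · rw [eq_neg_of_add_eq_zero_left hf]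
      apply Submodule.neg_mem
      exact Submodule.sum_mem _ fun j hj => Submodule.smul_mem _ _ (Submodule.subset_span ⟨j, hj, rfl⟩)
  choose h h0 hh using key
  refine ⟨∏ μ ∈ G, h μ, Finset.prod_ne_zero_iff.mpr fun μ _ => h0 μ, fun μ hμ => ?_⟩
  rw [← Finset.prod_erase_mul _ _ hμ, mul_smul]
  exact Submodule.smul_mem _ _ (hh μ hμ)

lemma spanA_le (P : Fin (t + 1) → MvPolynomial (Fin (t + 1)) F)
    (B : Finset (Fin (t + 1) →₀ ℕ)) (p : MvPolynomial (Fin (t + 1)) F)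
    (hp : p ∈ Submodule.span (Algebra.adjoin F (Set.range P))
          ((fun μ => monomial μ (1 : F)) '' (B : Set (Fin (t + 1) →₀ ℕ)))) :
    p ∈ Submodule.span F (rv P '' {x | x.2 ∈ B}) := by
  set W := Submodule.span F (rv P '' {x | x.2 ∈ B}) with hW
  have key : ∀ a ∈ Algebra.adjoin F (Set.range P), ∀ x ∈ W, a * x ∈ W := by
    intro a ha
    induction ha using Algebra.adjoin_induction with
    | mem a ha =>
      obtain ⟨i, rfl⟩ := ha
      intro x hx
      have h3 := Submodule.mem_map_of_mem (f := LinearMap.mulLeft F (P i)) hx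
      rw [hW, Submodule.map_span] at h3
      refine Submodule.span_mono ?_ h3
      rintro _ ⟨_, ⟨x, hx, rfl⟩, rfl⟩
      exact ⟨(x.1 + Finsupp.single i 1, x.2), hx, by rw [LinearMap.mulLeft_apply, mul_rv]⟩
    | algebraMap r => intro x hx; rw [← Algebra.smul_def]; exact W.smul_mem _ hx
    | add x y _ _ hx hy => intro z hz; rw [add_mul]; exact W.add_mem (hx z hz) (hy z hz)
    | mul x y _ _ hx hy => intro z hz; rw [mul_assoc]; exact hx _ (hy z hz)
  induction hp using Submodule.span_induction with
  | mem p hp =>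
    obtain ⟨μ, hμ, rfl⟩ := hp
    exact Submodule.subset_span ⟨(0, μ), hμ, by simp [rv, rowP]⟩
  | zero => simp
  | add x y _ _ hx hy => exact W.add_mem hx hy
  | smul a x _ hx => rw [Subalgebra.smul_def]; exact key _ a.2 _ hx

lemma hc_span {E : ℕ} (P : Fin (t + 1) → MvPolynomial (Fin (t + 1)) F)
    (hP : ∀ i, (P i).IsHomogeneous E) (N : ℕ)
    (B : Finset (Fin (t + 1) →₀ ℕ)) (p : MvPolynomial (Fin (t + 1)) F)
    (hp : p ∈ Submodule.span F (rv P '' {x | x.2 ∈ B})) :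
    homogeneousComponent N p ∈
      Submodule.span F (rv P '' {x | x.2 ∈ B ∧ E * x.1.degree + x.2.degree = N}) := by
  have h3 := Submodule.mem_map_of_mem (f := homogeneousComponent N) hp
  rw [Submodule.map_span] at h3
  refine Submodule.span_le.mpr ?_ h3
  rintro _ ⟨_, ⟨x, hx, rfl⟩, rfl⟩
  rw [homogeneousComponent_of_mem (rv_homog P hP x)]
  split_ifs with h
  · exact Submodule.subset_span ⟨x, ⟨hx, h.symm⟩, rfl⟩
  · simp

end P4c

end WrapP4c

section WrapP4d
open scoped BigOperators

section P4d
open MvPolynomial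

variable {F : Type} [Field F] {t : ℕ}

lemma pow_le_of_choose {E r c t : ℕ}
    (h : ∀ n, (E * n + t).choose t ≤ r * (n + c + t).choose t) : E ^ t ≤ r := by
  have h1 : ∀ n : ℕ, (E * n) ^ t ≤ r * (n + (c + t)) ^ t := by
    intro n
    have h2 := Nat.mul_le_mul_left t.factorial (h n)
    rw [mul_left_comm, ← Nat.descFactorial_eq_factorial_mul_choose,
      ← Nat.descFactorial_eq_factorial_mul_choose] at h2
    have h3 := Nat.pow_sub_le_descFactorial (E * n + t) t
    have h4 := Nat.descFactorial_le_pow (n + c + t) t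
    calc (E * n) ^ t ≤ (E * n + t + 1 - t) ^ t := Nat.pow_le_pow_left (by omega) _
      _ ≤ _ := h3
      _ ≤ _ := h2
      _ ≤ r * (n + c + t) ^ t := Nat.mul_le_mul_left _ h4
      _ = _ := by rw [add_assoc]
  have h5 : Filter.Tendsto (fun n : ℕ => (r : ℝ) * (1 + ((c + t : ℕ) : ℝ) / n) ^ t) Filter.atTop
      (nhds ((r : ℝ) * (1 + 0) ^ t)) := by
    apply Filter.Tendsto.const_mul
    apply Filter.Tendsto.pow
    exact tendsto_const_nhds.add (tendsto_const_div_atTop_nhds_zero_nat _)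
  have h6 : ((E ^ t : ℕ) : ℝ) ≤ (r : ℝ) * (1 + 0) ^ t := by
    apply ge_of_tendsto h5
    filter_upwards [Filter.eventually_ge_atTop 1] with n hn
    have hn' : (0 : ℝ) < n := by exact_mod_cast hn
    have h7 : (((E * n) ^ t : ℕ) : ℝ) ≤ ((r * (n + (c + t)) ^ t : ℕ) : ℝ) := by exact_mod_cast h1 n
    have h8 : (1 + ((c + t : ℕ) : ℝ) / n) = (n + (c + t : ℕ)) / n := by field_simp
    rw [h8, div_pow, mul_div_assoc', le_div_iff₀ (by positivity)]
    push_cast at h7 ⊢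
    rw [mul_pow] at h7
    linarith
  simp only [add_zero, one_pow, mul_one] at h6
  exact_mod_cast h6

lemma card_B_ge {E k0 : ℕ} (hE : 1 ≤ E) (P : Fin (t + 1) → MvPolynomial (Fin (t + 1)) F)
    (hP : ∀ i, (P i).IsHomogeneous E)
    (hsp : ∀ n, ∀ p : MvPolynomial (Fin (t + 1)) F, p.IsHomogeneous (E * n) →
      p ∈ Submodule.span F (rv P '' RR t E n (GG t E k0)))
    (B : Finset (Fin (t + 1) →₀ ℕ))
    (h : Algebra.adjoin F (Set.range P)) (h0 : h ≠ 0)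
    (hh : ∀ μ ∈ GG t E k0, h • monomial μ (1 : F) ∈
        Submodule.span (Algebra.adjoin F (Set.range P))
          ((fun μ => monomial μ (1 : F)) '' (B : Set (Fin (t + 1) →₀ ℕ)))) :
    E ^ t ≤ B.card := by
  classical
  obtain ⟨e, he⟩ : ∃ e, homogeneousComponent e (h : MvPolynomial (Fin (t + 1)) F) ≠ 0 := by
    by_contra hcon
    push Not at hcon
    apply h0
    have := sum_homogeneousComponent (h : MvPolynomial (Fin (t + 1)) F)
    rw [Finset.sum_eq_zero (fun i _ => hcon i)] at this
    exact Subtype.ext this.symm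
  set h' := homogeneousComponent e (h : MvPolynomial (Fin (t + 1)) F) with hh'
  have hmul : ∀ n, ∀ p : MvPolynomial (Fin (t + 1)) F, p.IsHomogeneous (E * n) →
      h' * p ∈ Submodule.span F
        (rv P '' {x | x.2 ∈ B ∧ E * x.1.degree + x.2.degree = e + E * n}) := by
    intro n p hp
    rw [hh', ← hc_mul _ _ _ _ hp]
    apply hc_span P hP
    apply spanA_le
    have h1 := homog_mem_spanA P p (hsp n p hp)
    clear hp
    induction h1 using Submodule.span_induction with
    | mem p hp =>
      obtain ⟨μ, hμ, rfl⟩ := hp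
      exact hh μ hμ
    | zero => simp
    | add x y _ _ hx hy => rw [mul_add]; exact Submodule.add_mem _ hx hy
    | smul a x _ hx => rw [mul_smul_comm]; exact Submodule.smul_mem _ _ hx
  apply pow_le_of_choose (c := e)
  intro n
  set T : Finset (MvPolynomial (Fin (t + 1)) F) := (B.biUnion fun β =>
    (Finset.finsuppAntidiag (Finset.univ : Finset (Fin (t + 1))) ((e + E * n - β.degree) / E)).image
      fun a => rv P (a, β)) with hT
  have hTc : T.card ≤ B.card * (n + e + t).choose t := by
    apply Finset.card_biUnion_le_card_mul
    intro β _
    refine Finset.card_image_le.trans ?_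
    have := card_col t ((e + E * n - β.degree) / E)
    rw [Fintype.card_coe] at this
    rw [this]
    apply Nat.choose_le_choose
    have : (e + E * n - β.degree) / E ≤ n + e := by
      apply Nat.div_le_of_le_mul
      have : e ≤ E * e := Nat.le_mul_of_pos_left _ hE
      rw [mul_add]
      omega
    omega
  refine le_trans ?_ hTc
  have hli : LinearIndependent F (fun ν : Col t (E * n) => h' * monomial (ν : Fin (t + 1) →₀ ℕ) (1 : F)) := by
    have h2 := (basisMonomials (Fin (t + 1)) F).linearIndependent.map' (LinearMap.mulLeft F h')
      (LinearMap.ker_eq_bot.mpr fun x y hxy => mul_left_cancel₀ he hxy)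
    have h3 := h2.comp (fun ν : Col t (E * n) => (ν : Fin (t + 1) →₀ ℕ)) Subtype.val_injective
    have h4 : (fun ν : Col t (E * n) => h' * monomial (ν : Fin (t + 1) →₀ ℕ) (1 : F))
      = ((LinearMap.mulLeft F h') ∘ (basisMonomials (Fin (t + 1)) F)) ∘
        (fun ν : Col t (E * n) => (ν : Fin (t + 1) →₀ ℕ)) := by
      funext ν; simp
    rw [h4]; exact h3
  have := linearIndependent_le_span' _ hli (T : Set (MvPolynomial (Fin (t + 1)) F)) (by
    rintro _ ⟨ν, rfl⟩
    have hd : (ν : Fin (t + 1) →₀ ℕ).degree = E * n := mem_col.mp ν.2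
    have h5 := hmul n _ (isHomogeneous_monomial (1 : F) hd)
    refine Submodule.span_mono ?_ h5
    rintro _ ⟨x, ⟨hx1, hx2⟩, rfl⟩
    rw [hT]
    simp only [Finset.coe_biUnion, Set.mem_iUnion, Finset.mem_coe, Finset.mem_image]
    refine ⟨x.2, hx1, x.1, ?_, rfl⟩
    rw [mem_col, ← hx2, Nat.add_sub_cancel, Nat.mul_div_cancel_left _ hE])
  rw [Cardinal.mk_fintype, card_col] at this
  have h9 : (E * n + t).choose t ≤ Fintype.card (T : Set (MvPolynomial (Fin (t + 1)) F)) := by exact_mod_cast this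
  simpa using h9

end P4d

end WrapP4d

section WrapP4e
open scoped BigOperators

section P4e
open MvPolynomial

variable {F : Type} [Field F] {t : ℕ}

lemma sum_col_coord (m : ℕ) (i : Fin (t + 1)) :
    (t + 1) * ∑ a ∈ Finset.finsuppAntidiag (Finset.univ : Finset (Fin (t + 1))) m, a i
      = m * (m + t).choose t := by
  have hc := card_col t m
  rw [Fintype.card_coe] at hc
  have hsym : ∀ j, ∑ a ∈ Finset.finsuppAntidiag (Finset.univ : Finset (Fin (t + 1))) m, a j
      = ∑ a ∈ Finset.finsuppAntidiag (Finset.univ : Finset (Fin (t + 1))) m, a i := by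
    intro j
    have hdeg : ∀ a : Fin (t + 1) →₀ ℕ, (a.equivMapDomain (Equiv.swap i j)).degree = a.degree := by
      intro a
      rw [Finsupp.degree_eq_sum, Finsupp.degree_eq_sum]
      simp only [Finsupp.equivMapDomain_apply]
      exact Equiv.sum_comp (Equiv.swap i j).symm (fun k => a k)
    refine Finset.sum_nbij' (fun a => a.equivMapDomain (Equiv.swap i j))
      (fun a => a.equivMapDomain (Equiv.swap i j)) ?_ ?_ ?_ ?_ ?_
    · intro a ha; rw [mem_col] at ha ⊢; rw [hdeg, ha]
    · intro a ha; rw [mem_col] at ha ⊢; rw [hdeg, ha]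
    · intro a _; ext k; simp [Finsupp.equivMapDomain_apply]
    · intro a _; ext k; simp [Finsupp.equivMapDomain_apply]
    · intro a _; simp [Finsupp.equivMapDomain_apply]
  calc (t + 1) * ∑ a ∈ Finset.finsuppAntidiag (Finset.univ : Finset (Fin (t + 1))) m, a i
      = ∑ j : Fin (t + 1), ∑ a ∈ Finset.finsuppAntidiag (Finset.univ : Finset (Fin (t + 1))) m, a j := by
        simp only [hsym]; simp
    _ = ∑ a ∈ Finset.finsuppAntidiag (Finset.univ : Finset (Fin (t + 1))) m, ∑ j, a j := Finset.sum_comm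
    _ = ∑ a ∈ Finset.finsuppAntidiag (Finset.univ : Finset (Fin (t + 1))) m, m := by
        apply Finset.sum_congr rfl
        intro a ha
        rw [mem_col, Finsupp.degree_eq_sum] at ha
        exact ha
    _ = _ := by rw [Finset.sum_const, hc, smul_eq_mul, mul_comm]

lemma det_ne_zero_of_li {N : ℕ} (P : Fin (t + 1) → MvPolynomial (Fin (t + 1)) F)
    (a : Col t N → Fin (t + 1) → ℕ) (μ : Col t N → Fin (t + 1) →₀ ℕ)
    (hh : ∀ s, (rowP P (a s) (μ s)).IsHomogeneous N)
    (hli : LinearIndependent F fun s => rowP P (a s) (μ s)) : (rowMat P a μ).det ≠ 0 := by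
  rw [← isUnit_iff_ne_zero, ← Matrix.isUnit_iff_isUnit_det, ← Matrix.linearIndependent_rows_iff_isUnit,
    Fintype.linearIndependent_iff]
  intro g hg
  apply Fintype.linearIndependent_iff.mp hli
  ext ν
  by_cases hν : ν.degree = N
  · have := congrFun hg ⟨ν, mem_col.mpr hν⟩
    simp only [Finset.sum_apply, Pi.smul_apply, Matrix.row_apply, rowMat, Matrix.of_apply, Pi.zero_apply] at this
    simpa [coeff_sum] using this
  · rw [coeff_sum, Finset.sum_eq_zero, coeff_zero]
    intro s _
    rw [coeff_smul, (hh s).coeff_eq_zero, smul_zero]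
    rwa [Finsupp.degree_eq_sum, ← Finsupp.degree_eq_sum]

lemma ext_card {E n k0 : ℕ} (P : Fin (t + 1) → MvPolynomial (Fin (t + 1)) F)
    (hP : ∀ i, (P i).IsHomogeneous E)
    (hsp : ∀ n, ∀ p : MvPolynomial (Fin (t + 1)) F, p.IsHomogeneous (E * n) →
      p ∈ Submodule.span F (rv P '' RR t E n (GG t E k0)))
    (b : Set ((Fin (t + 1) →₀ ℕ) × (Fin (t + 1) →₀ ℕ)))
    (hb : b ⊆ RR t E n (GG t E k0)) (hspan : rv P '' RR t E n (GG t E k0) ⊆ Submodule.span F (rv P '' b))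
    (hli : LinearIndepOn F (rv P) b) : ∃ _ : Fintype b, Fintype.card b = Fintype.card (Col t (E * n)) := by
  classical
  set V : Col t (E * n) → MvPolynomial (Fin (t + 1)) F :=
    fun ν => monomial (ν : Fin (t + 1) →₀ ℕ) (1 : F) with hV
  have hliV : LinearIndependent F V := by
    have h3 := (basisMonomials (Fin (t + 1)) F).linearIndependent.comp
      (fun ν : Col t (E * n) => (ν : Fin (t + 1) →₀ ℕ)) Subtype.val_injective
    have h4 : V = (basisMonomials (Fin (t + 1)) F) ∘
        (fun ν : Col t (E * n) => (ν : Fin (t + 1) →₀ ℕ)) := by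
      funext ν; simp [hV]
    rw [h4]; exact h3
  have h1 := linearIndependent_le_span' _ hli (Set.range V) (by
    rintro _ ⟨x, rfl⟩
    have hx := rv_homog P hP x.1
    rw [(hb x.2).1] at hx
    apply homog_mem_span_monomials _ hx
    intro ν hν
    exact Submodule.subset_span ⟨⟨ν, mem_col.mpr hν⟩, rfl⟩)
  have hfin : Finite b := by
    rw [← Cardinal.lt_aleph0_iff_finite]
    exact h1.trans_lt (Cardinal.natCast_lt_aleph0)
  have : Fintype b := Fintype.ofFinite b
  refine ⟨this, le_antisymm ?_ ?_⟩
  · rw [Cardinal.mk_fintype, Set.card_range_of_injective hliV.injective] at h1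
    exact_mod_cast h1
  · have hspan' : Submodule.span F (rv P '' RR t E n (GG t E k0)) ≤ Submodule.span F (rv P '' b) :=
      Submodule.span_le.mpr hspan
    have h2 := linearIndependent_le_span' _ hliV (Set.range fun x : b => rv P x) (by
      rintro _ ⟨ν, rfl⟩
      have := hspan' (hsp n _ (isHomogeneous_monomial (1 : F) (mem_col.mp ν.2)))
      rwa [Set.image_eq_range] at this)
    rw [Cardinal.mk_fintype] at h2
    have h3 : Fintype.card (Col t (E * n)) ≤ Fintype.card (Set.range fun x : b => rv P x) := by
      exact_mod_cast h2
    exact h3.trans (Fintype.card_range_le _)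

end P4e

end WrapP4e

section WrapP4f
open scoped BigOperators

section P4f
open MvPolynomial

variable {F : Type} [Field F] {t : ℕ}

lemma rows_exist {E : ℕ} (hE : 1 ≤ E) (P : Fin (t + 1) → MvPolynomial (Fin (t + 1)) F)
    (hP : ∀ i, (P i).IsHomogeneous E)
    (hnull : ∀ j, ∃ k, (X j : MvPolynomial (Fin (t + 1)) F) ^ k ∈ Ideal.span (Set.range P)) :
    (∀ i, P i ≠ 0) ∧ ∃ k0 r, E ^ t ≤ r ∧ ∀ n, k0 ≤ n →
      ∃ (a : Col t (E * n) → Fin (t + 1) → ℕ) (μ : Col t (E * n) → Fin (t + 1) →₀ ℕ),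
      (rowMat P a μ).det ≠ 0 ∧ (∀ s, E * ∑ i, a s i + (μ s).degree = E * n) ∧
      (∀ s, n ≤ ∑ i, a s i + k0) ∧
      ∀ i, (t + 1) * ∑ s, a s i + (t + 1) * n * (r * (n - k0 + t).choose t)
        ≤ r * (n * (n + t).choose t) + (t + 1) * n * (E * n + t).choose t := by
  classical
  obtain ⟨k0, hsp⟩ := exists_span hE P hP hnull
  have hai := algInd hE P hsp
  refine ⟨fun i => hai.ne_zero i, ?_⟩
  obtain ⟨B, hBG, hBli, h, h0, hh⟩ := exists_maxB P (GG t E k0)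
  have hr := card_B_ge hE P hP hsp B h h0 hh
  refine ⟨k0, B.card, hr, fun n hn => ?_⟩
  have hli0 : LinearIndepOn F (rv P) (RR t E n B) := (li_rv P hai B hBli).mono fun x hx => hx.2
  obtain ⟨b, hb, hRb, hspan, hli⟩ := exists_linearIndepOn_extension hli0
    (t := RR t E n (GG t E k0)) (fun x hx => ⟨hx.1, hBG hx.2⟩)
  obtain ⟨_, hcard⟩ := ext_card P hP hsp b hb hspan hli
  let e : Col t (E * n) ≃ b := Fintype.equivOfCardEq hcard.symm
  have hdeg : ∀ x ∈ b, E * ∑ i, x.1 i + x.2.degree = E * n := by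
    intro x hx
    have := (hb hx).1
    rwa [Finsupp.degree_eq_sum x.1] at this
  refine ⟨fun s => (e s).1.1, fun s => (e s).1.2, ?_, fun s => hdeg _ (e s).2, fun s => ?_, fun i => ?_⟩
  · apply det_ne_zero_of_li
    · intro s
      have := rv_homog P hP (e s).1
      rwa [(hb (e s).2).1] at this
    · exact hli.comp e e.injective
  · have h1 := hdeg _ (e s).2
    obtain ⟨k, hk, hkd⟩ := mem_GG.mp (hb (e s).2).2
    rw [hkd, ← mul_add] at h1
    have := Nat.eq_of_mul_eq_mul_left hE h1
    dsimp only
    omega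
  · have hsum : ∑ s, (e s).1.1 i = ∑ x ∈ b.toFinset, x.1 i := by
      rw [Equiv.sum_comp e (fun x => x.1.1 i)]
      exact (Finset.sum_subtype _ (by simp) (fun x : (Fin (t + 1) →₀ ℕ) × (Fin (t + 1) →₀ ℕ) => x.1 i)).symm
    have hbc : b.toFinset.card = (E * n + t).choose t := by
      rw [Set.toFinset_card, hcard, card_col]
    set RB := b.toFinset.filter (fun x => x ∈ RR t E n B) with hRB
    have hRBmem : ∀ x, x ∈ RB ↔ x.2 ∈ B ∧ x.1 ∈ Finset.finsuppAntidiag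
        (Finset.univ : Finset (Fin (t + 1))) (n - x.2.degree / E) := by
      intro x
      rw [hRB, Finset.mem_filter, Set.mem_toFinset, and_iff_right_of_imp (fun h => hRb h), mem_col]
      constructor
      · rintro ⟨h1, h2⟩
        refine ⟨h2, ?_⟩
        obtain ⟨k, hk, hkd⟩ := mem_GG.mp (hBG h2)
        rw [hkd, ← mul_add] at h1
        have := Nat.eq_of_mul_eq_mul_left hE h1
        rw [hkd, Nat.mul_div_cancel_left _ hE]
        omega
      · rintro ⟨h2, h1⟩
        refine ⟨?_, h2⟩
        obtain ⟨k, hk, hkd⟩ := mem_GG.mp (hBG h2)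
        rw [hkd, Nat.mul_div_cancel_left _ hE] at h1
        rw [hkd, h1, ← mul_add]
        congr 1
        omega
    have hRBc : B.card * (n - k0 + t).choose t ≤ RB.card := by
      rw [Finset.card_eq_sum_ones RB, Finset.sum_finset_product_right RB B (fun β => Finset.finsuppAntidiag
        (Finset.univ : Finset (Fin (t + 1))) (n - β.degree / E)) hRBmem, ← smul_eq_mul,
        ← Finset.sum_const]
      apply Finset.sum_le_sum
      intro β hβ
      rw [← Finset.card_eq_sum_ones]
      have := card_col t (n - β.degree / E)
      rw [Fintype.card_coe] at this
      rw [this]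
      apply Nat.choose_le_choose
      obtain ⟨k, hk, hkd⟩ := mem_GG.mp (hBG hβ)
      rw [hkd, Nat.mul_div_cancel_left _ hE]
      omega
    have hRBs : (t + 1) * ∑ x ∈ RB, x.1 i ≤ B.card * (n * (n + t).choose t) := by
      rw [Finset.sum_finset_product_right RB B (fun β => Finset.finsuppAntidiag
        (Finset.univ : Finset (Fin (t + 1))) (n - β.degree / E)) hRBmem, Finset.mul_sum, ← smul_eq_mul (B.card),
        ← Finset.sum_const]
      apply Finset.sum_le_sum
      intro β hβ
      dsimp only
      rw [sum_col_coord]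
      exact Nat.mul_le_mul (Nat.sub_le _ _) (Nat.choose_le_choose _
        (Nat.add_le_add_right (Nat.sub_le _ _) _))
    have hsplit := Finset.sum_filter_add_sum_filter_not b.toFinset (fun x => x ∈ RR t E n B) (fun x => x.1 i)
    have hcs := Finset.card_filter_add_card_filter_not (s := b.toFinset) (fun x => x ∈ RR t E n B)
    set RN := b.toFinset.filter (fun x => x ∉ RR t E n B) with hRN
    have hRNs : ∑ x ∈ RN, x.1 i ≤ RN.card * n := by
      rw [← smul_eq_mul, ← Finset.sum_const]
      apply Finset.sum_le_sum
      intro x hx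
      rw [hRN, Finset.mem_filter, Set.mem_toFinset] at hx
      have h1 := hdeg x hx.1
      have h2 : ∑ i, x.1 i ≤ n := Nat.le_of_mul_le_mul_left (by omega) hE
      exact (Finset.single_le_sum (f := fun i => x.1 i) (fun _ _ => Nat.zero_le _) (Finset.mem_univ i)).trans h2
    rw [hsum, ← hsplit, ← hbc, ← hcs]
    have h5 := Nat.mul_le_mul_left ((t + 1) * n) hRBc
    have h6 := Nat.mul_le_mul_left (t + 1) hRNs
    simp only [mul_add] at *
    nlinarith

end P4f

end WrapP4f

section WrapP5a
open scoped BigOperators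

section P5a
open MvPolynomial

lemma mm_pos {t : ℕ} (D : Fin (t + 1) → ℕ) (hD : ∀ i, 1 ≤ D i) (i) : 1 ≤ mm D i :=
  Finset.one_le_prod' fun j _ => hD j

lemma exists_rows (K : IntermediateField ℚ ℂ) {t : ℕ} (D : Fin (t + 1) → ℕ) (hD : ∀ i, 1 ≤ D i)
    (Q : Fin (t + 1) → MvPolynomial (Fin (t + 1)) K)
    (hQ : ∀ i, (Q i).IsHomogeneous (D i))
    (hnz : ¬∃ z : Fin (t + 1) → ℂ, z ≠ 0 ∧ ∀ i, MvPolynomial.aeval z (Q i) = 0) :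
    (∀ i, Q i ≠ 0) ∧ ∃ k0 r, (∏ j, D j) ^ t ≤ r ∧ ∀ n, k0 ≤ n →
      ∃ (a : Col t ((∏ j, D j) * n) → Fin (t + 1) → ℕ)
        (μ : Col t ((∏ j, D j) * n) → Fin (t + 1) →₀ ℕ),
      (rowMat Q (fun s i => mm D i * a s i) μ).det ≠ 0 ∧
      (∀ s, (∏ j, D j) * ∑ i, a s i + (μ s).degree = (∏ j, D j) * n) ∧
      (∀ s, n ≤ ∑ i, a s i + k0) ∧
      ∀ i, (t + 1) * ∑ s, a s i + (t + 1) * n * (r * (n - k0 + t).choose t)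
        ≤ r * (n * (n + t).choose t) + (t + 1) * n * ((∏ j, D j) * n + t).choose t := by
  have hE : 1 ≤ ∏ j, D j := Finset.one_le_prod' fun j _ => hD j
  have hP : ∀ i, (Q i ^ mm D i).IsHomogeneous (∏ j, D j) := by
    intro i
    rw [← D_mul_mm D i]
    exact (hQ i).pow _
  obtain ⟨h1, k0, r, hr, h2⟩ := rows_exist hE (fun i => Q i ^ mm D i) hP (by
    intro j
    have h3 : (X j : MvPolynomial (Fin (t + 1)) K) ∈
        (Ideal.span (Set.range fun i => Q i ^ mm D i)).radical := by
      rw [← vanishingIdeal_zeroLocus_eq_radical (K := ℂ), mem_vanishingIdeal_iff]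
      intro x hx
      rw [mem_zeroLocus_iff] at hx
      have hx0 : x = 0 := by
        by_contra hne
        apply hnz
        refine ⟨x, hne, fun i => ?_⟩
        have := hx _ (Ideal.subset_span ⟨i, rfl⟩)
        rw [map_pow] at this
        exact eq_zero_of_pow_eq_zero this
      rw [hx0, aeval_X]; rfl
    exact h3)
  refine ⟨fun i h0 => h1 i ?_, k0, r, hr, fun n hn => ?_⟩
  · rw [h0, zero_pow]
    have := mm_pos D hD i
    omega
  · obtain ⟨a, μ, h3, h4⟩ := h2 n hn
    refine ⟨a, μ, ?_, h4⟩
    have : rowMat (fun i => Q i ^ mm D i) a μ = rowMat Q (fun s i => mm D i * a s i) μ := by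
      unfold rowMat rowP
      simp only [pow_mul]
    rwa [← this]

lemma choose_le_pow' (D t : ℕ) : (D + t).choose t ≤ (t + 1) ^ D := by
  have h : ∀ D, (D + t).choose D ≤ (t + 1) ^ D := by
    intro D
    induction D with
    | zero => simp
    | succ D ih =>
      have h1 := Nat.add_one_mul_choose_eq (D + t) D
      have h2 : (D + t).succ ≤ (t + 1) * (D + 1) := by
        rw [Nat.succ_eq_add_one]; nlinarith
      have h3 : (D + 1 + t).choose (D + 1) * (D + 1) ≤ (t + 1) ^ (D + 1) * (D + 1) := by
        have : D + 1 + t = D + t + 1 := by omega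
        rw [this, ← h1]
        calc (D + t + 1) * (D + t).choose D ≤ ((t + 1) * (D + 1)) * (t + 1) ^ D := Nat.mul_le_mul h2 ih
          _ = _ := by ring
      exact Nat.le_of_mul_le_mul_right h3 (by omega)
  rw [Nat.choose_symm_add.symm]
  exact h D

lemma l1_map_le (K : IntermediateField ℚ ℂ) [NumberField K] {t D : ℕ}
    (Q : MvPolynomial (Fin (t + 1)) K)
    (hQ : Q.IsHomogeneous D) (σ : K →+* ℂ) :
    l1 (map σ Q) ≤ (t + 1) ^ D * sN K Q σ := by
  have hs : (map σ Q).support ⊆ Finset.finsuppAntidiag (Finset.univ : Finset (Fin (t + 1))) D := by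
    intro m hm
    have := (hQ.map σ) (mem_support_iff.mp hm)
    rw [mem_col, Finsupp.degree_eq_weight_one]
    exact this
  rw [l1_eq _ _ hs]
  have hc := card_col t D
  rw [Fintype.card_coe] at hc
  calc ∑ m ∈ Finset.finsuppAntidiag (Finset.univ : Finset (Fin (t + 1))) D, ‖coeff m (map σ Q)‖
      ≤ ∑ m ∈ Finset.finsuppAntidiag (Finset.univ : Finset (Fin (t + 1))) D, sN K Q σ := by
        apply Finset.sum_le_sum
        intro m _
        rw [coeff_map]; exact le_sN K Q σ m
    _ = ((D + t).choose t : ℕ) * sN K Q σ := by rw [Finset.sum_const, hc, nsmul_eq_mul]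
    _ ≤ _ := by
        apply mul_le_mul_of_nonneg_right _ (sN_nonneg K Q σ)
        exact_mod_cast choose_le_pow' D t

lemma core_ineq (K : IntermediateField ℚ ℂ) [NumberField K] {t n k : ℕ} (D : Fin (t + 1) → ℕ)
    (hD : ∀ i, 1 ≤ D i)
    (Q : Fin (t + 1) → MvPolynomial (Fin (t + 1)) K) (hQ : ∀ i, (Q i).IsHomogeneous (D i))
    (hQ0 : ∀ i, Q i ≠ 0)
    (ξ : Fin t → ℂ) (ε : ℝ) (hε0 : 0 < ε) (hε1 : ε < 1)
    (hM : ∀ i, ‖(aeval (Fin.cons 1 ξ) (Q i) : ℂ)‖ ≤ ε * polyNorm K (Q i))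
    (a : Col t ((∏ j, D j) * n) → Fin (t + 1) → ℕ) (μ : Col t ((∏ j, D j) * n) → Fin (t + 1) →₀ ℕ)
    (hdet : (rowMat Q (fun s i => mm D i * a s i) μ).det ≠ 0)
    (hrow : ∀ s, (∏ j, D j) * ∑ i, a s i + (μ s).degree = (∏ j, D j) * n)
    (hge : ∀ s, k ≤ ∑ i, a s i) (hk : t + 1 ≤ k) (hkn : k ≤ n) :
    1 ≤ ε ^ ((∏ j, D j) ^ t * k.choose (t + 1)) *
      ∏ i, ((((t : ℝ) + 1) ^ D i + 2) ^ (Module.finrank ℚ K) * polyH K (Q i) ^ (Module.finrank ℚ K))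
        ^ (mm D i * ∑ s, a s i) := by
  classical
  have h1 := prod_absNorm_le K Q _ μ hdet
  set σ0 : K →+* ℂ := algebraMap K ℂ with hσ0
  set e := (∏ j, D j) ^ t * k.choose (t + 1) with he
  set c : Fin (t + 1) → ℝ := fun i => ((t : ℝ) + 1) ^ D i + 2 with hc
  have hc0 : ∀ i, 0 ≤ c i := fun i => by positivity
  have hnorm : ∀ i, polyNorm K (Q i) = sN K (Q i) σ0 := fun i => rfl
  have hl : ∀ σ i, l1 (map σ (Q i)) ≤ ((t : ℝ) + 1) ^ D i * sN K (Q i) σ := fun σ i =>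
    l1_map_le K (Q i) (hQ i) σ
  have hσ : ∀ σ : K →+* ℂ, ‖σ (rowMat Q (fun s i => mm D i * a s i) μ).det‖ ≤
      (if σ = σ0 then ε ^ e else 1) * ∏ i, (c i * sN K (Q i) σ) ^ (mm D i * ∑ s, a s i) := by
    intro σ
    rw [← rowMat_map_det]
    split_ifs with h
    · have h3 := det_small' D hD (fun i => map σ (Q i)) (fun i => (hQ i).map σ) ξ ε hε0 hε1
        (fun i => polyNorm K (Q i)) (fun i => by
          have := hM i
          rw [aeval_def, ← eval_map] at this
          rw [h]; exact this) a μ hrow hge hk hkn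
      refine h3.trans ?_
      apply mul_le_mul_of_nonneg_left _ (by positivity)
      apply Finset.prod_le_prod
      · intro i _
        have := l1_nonneg (map σ (Q i))
        have := sN_nonneg K (Q i) σ0
        have := hnorm i
        positivity
      · intro i _
        have h4 := l1_nonneg (map σ (Q i))
        have h5 := sN_nonneg K (Q i) σ0
        rw [hnorm i]
        apply pow_le_pow_left₀ (by positivity)
        have := hl σ i
        rw [h] at this ⊢
        simp only [hc]
        linarith
    · rw [one_mul]
      have h3 := norm_rowMat_det_le (fun i => map σ (Q i)) (fun s i => mm D i * a s i) μ
        (fun i => c i * sN K (Q i) σ) (fun i => by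
          have := hl σ i
          have := sN_nonneg K (Q i) σ
          simp only [hc]
          linarith)
      simpa only [Finset.mul_sum] using h3
  have h2 : ∏ σ : K →+* ℂ, ‖σ (rowMat Q (fun s i => mm D i * a s i) μ).det‖ ≤
      ∏ σ : K →+* ℂ, ((if σ = σ0 then ε ^ e else 1) * ∏ i, (c i * sN K (Q i) σ) ^ (mm D i * ∑ s, a s i)) :=
    Finset.prod_le_prod (fun _ _ => norm_nonneg _) fun σ _ => hσ σ
  rw [Finset.prod_mul_distrib, Finset.prod_ite_eq' Finset.univ σ0, if_pos (Finset.mem_univ _),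
    Finset.prod_comm] at h2
  have h3 : ∀ i, ∏ σ : K →+* ℂ, (c i * sN K (Q i) σ) ^ (mm D i * ∑ s, a s i)
      = (c i ^ Module.finrank ℚ K * polyH K (Q i) ^ (Module.finrank ℚ K)) ^ (mm D i * ∑ s, a s i)
        * ((FractionalIdeal.absNorm (cIdeal K (Q i)) : ℚ) : ℝ) ^ (mm D i * ∑ s, a s i) := by
    intro i
    have h6 := absNorm_cIdeal_pos K (Q i) (hQ0 i)
    rw [Finset.prod_pow, Finset.prod_mul_distrib, Finset.prod_const, Finset.card_univ,
      NumberField.Embeddings.card, ← mul_pow, polyH_pow]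
    congr 1
    field_simp
  simp only [h3] at h2
  rw [Finset.prod_mul_distrib] at h2
  simp only [← Finset.mul_sum] at h1
  have h7 := h1.trans h2
  have h8 : 0 < ∏ i, ((FractionalIdeal.absNorm (cIdeal K (Q i)) : ℚ) : ℝ) ^ (mm D i * ∑ s, a s i) :=
    Finset.prod_pos fun i _ => pow_pos (absNorm_cIdeal_pos K (Q i) (hQ0 i)) _
  rw [← mul_assoc] at h7
  exact le_of_mul_le_mul_right (by rwa [one_mul]) h8

end P5a

end WrapP5a

section WrapP5b
open scoped BigOperators

section P5b
open MvPolynomial Filter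

lemma choose_limit (f : ℕ → ℕ) (α : ℝ) (hf : Tendsto (fun n => (f n : ℝ) / n) atTop (nhds α)) (m : ℕ) :
    Tendsto (fun n : ℕ => ((f n).choose m : ℝ) / (n : ℝ) ^ m) atTop (nhds (α ^ m / m.factorial)) := by
  induction m with
  | zero => simp
  | succ m ih =>
    have h1 : Tendsto (fun n : ℕ => ((f n : ℝ) / n - (m : ℝ) / n) / (m + 1)) atTop
        (nhds ((α - 0) / (m + 1))) :=
      (hf.sub (tendsto_const_div_atTop_nhds_zero_nat _)).div_const _
    have h2 := ih.mul h1
    have h3 : α ^ m / m.factorial * ((α - 0) / (m + 1)) = α ^ (m + 1) / (m + 1).factorial := by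
      rw [Nat.factorial_succ]; push_cast
      have : (m.factorial : ℝ) ≠ 0 := by positivity
      field_simp
      ring
    rw [h3] at h2
    refine h2.congr' ?_
    filter_upwards [eventually_ge_atTop 1] with n hn
    have hn' : (n : ℝ) ≠ 0 := by positivity
    have h4 : ((f n).choose (m + 1) : ℝ) * (m + 1) = (f n).choose m * ((f n : ℝ) - m) := by
      have := Nat.choose_succ_right_eq (f n) m
      by_cases h : m ≤ f n
      · rw [← Nat.cast_sub h]; exact_mod_cast this
      · rw [Nat.choose_eq_zero_of_lt (by omega), Nat.choose_eq_zero_of_lt (by omega)]; simp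
    have h5 : ((f n).choose (m + 1) : ℝ) = (f n).choose m * ((f n : ℝ) - m) / (m + 1) := by
      rw [eq_div_iff (by positivity), h4]
    rw [h5]
    field_simp
    ring

lemma lin_limit (α β k : ℕ) :
    Tendsto (fun n : ℕ => (((α * (n - k) + β : ℕ) : ℝ)) / n) atTop (nhds (α : ℝ)) := by
  have h1 : Tendsto (fun n : ℕ => (α : ℝ) + ((β : ℝ) - α * k) / n) atTop (nhds ((α : ℝ) + 0)) :=
    tendsto_const_nhds.add (tendsto_const_div_atTop_nhds_zero_nat _)
  rw [add_zero] at h1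
  refine h1.congr' ?_
  filter_upwards [eventually_ge_atTop (k + 1)] with n hn
  have hn' : (n : ℝ) ≠ 0 := by
    have : 0 < n := by omega
    positivity
  push_cast [Nat.cast_sub (show k ≤ n by omega)]
  field_simp
  ring

lemma limit_arg {t E r k0 : ℕ} (hE : 1 ≤ E) (hr : E ^ t ≤ r) (x y : ℝ) (hy : 0 ≤ y)
    (h : ∀ n, k0 + t + 1 ≤ n → 0 ≤ (t + 1) * ((E : ℝ) ^ t * (n - k0).choose (t + 1)) * x
      + (r * (n * (n + t).choose t) + (t + 1) * n * (E * n + t).choose t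
        - (t + 1) * n * (r * (n - k0 + t).choose t)) * y) : 0 ≤ x + y := by
  have l1 := choose_limit (fun n => n - k0) 1 (by simpa using lin_limit 1 0 k0) (t + 1)
  have l2 := choose_limit (fun n => n + t) 1 (by simpa using lin_limit 1 t 0) t
  have l3 := choose_limit (fun n => E * n + t) E (by simpa using lin_limit E t 0) t
  have l4 := choose_limit (fun n => n - k0 + t) 1 (by simpa using lin_limit 1 t k0) t
  have l5 := ((l1.const_mul (((t : ℝ) + 1) * (E : ℝ) ^ t)).mul_const x).add
    ((((l2.const_mul (r : ℝ)).add (l3.const_mul ((t : ℝ) + 1))).sub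
      (l4.const_mul (((t : ℝ) + 1) * r))).mul_const y)
  have h6 := ge_of_tendsto l5 (b := 0) (by
    filter_upwards [eventually_ge_atTop (k0 + t + 1)] with n hn
    have hn0 : 0 < n := by omega
    have hn' : (0 : ℝ) < n := by exact_mod_cast hn0
    have h7 := div_nonneg (h n hn) (pow_nonneg hn'.le (t + 1))
    refine h7.trans_eq ?_
    rw [pow_succ]
    field_simp)
  have hf : (0 : ℝ) < t.factorial := by positivity
  rw [Nat.factorial_succ] at h6
  push_cast at h6
  have h8 : ((t : ℝ) + 1) * (E : ℝ) ^ t * (1 ^ (t + 1) / ((t + 1) * t.factorial)) * x +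
      (r * (1 ^ t / t.factorial) + (t + 1) * ((E : ℝ) ^ t / t.factorial)
        - (t + 1) * r * (1 ^ t / t.factorial)) * y
      = ((E : ℝ) ^ t * x + ((E : ℝ) ^ t - t * (r - (E : ℝ) ^ t)) * y) / t.factorial := by
    simp only [one_pow]
    field_simp
    ring
  rw [h8] at h6
  have h9 : 0 ≤ (E : ℝ) ^ t * x + ((E : ℝ) ^ t - t * (r - (E : ℝ) ^ t)) * y := by
    by_contra hneg
    push Not at hneg
    exact absurd h6 (not_le.mpr (div_neg_of_neg_of_pos hneg hf))
  have hr' : (E : ℝ) ^ t ≤ r := by exact_mod_cast hr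
  have h10 : 0 ≤ (t : ℝ) * (r - (E : ℝ) ^ t) * y := by
    have : (0 : ℝ) ≤ r - (E : ℝ) ^ t := by linarith
    positivity
  have h11 : 0 ≤ (E : ℝ) ^ t * (x + y) := by nlinarith
  have h12 : (0 : ℝ) < (E : ℝ) ^ t := by positivity
  exact nonneg_of_mul_nonneg_right h11 h12

lemma small_case (K : IntermediateField ℚ ℂ) [NumberField K] {t : ℕ} (D : Fin (t + 1) → ℕ)
    (hD : ∀ i, 1 ≤ D i)
    (Q : Fin (t + 1) → MvPolynomial (Fin (t + 1)) K) (hQ : ∀ i, (Q i).IsHomogeneous (D i))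
    (hnz : ¬∃ z : Fin (t + 1) → ℂ, z ≠ 0 ∧ ∀ i, MvPolynomial.aeval z (Q i) = 0)
    (ξ : Fin t → ℂ) (ε : ℝ) (hε0 : 0 < ε) (hε1 : ε < 1)
    (hM : ∀ i, ‖(aeval (Fin.cons 1 ξ) (Q i) : ℂ)‖ ≤ ε * polyNorm K (Q i)) :
    1 ≤ (∏ i, ((((t : ℝ) + 1) ^ D i + 2) ^ (Module.finrank ℚ K) * polyH K (Q i) ^ (Module.finrank ℚ K))
        ^ (mm D i)) * ε := by
  obtain ⟨hQ0, k0, r, hr, hrows⟩ := exists_rows K D hD Q hQ hnz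
  have hE : 1 ≤ ∏ j, D j := Finset.one_le_prod' fun j _ => hD j
  set E := ∏ j, D j with hEdef
  set A : Fin (t + 1) → ℝ := fun i => (((t : ℝ) + 1) ^ D i + 2) ^ (Module.finrank ℚ K)
    * polyH K (Q i) ^ (Module.finrank ℚ K) with hA
  have hA1 : ∀ i, 1 ≤ A i := by
    intro i
    have h1 := one_le_polyH_pow K (Q i) (hQ0 i)
    have h2 : (1 : ℝ) ≤ ((t : ℝ) + 1) ^ D i + 2 := by
      have : (0 : ℝ) ≤ ((t : ℝ) + 1) ^ D i := by positivity
      linarith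
    exact one_le_mul_of_one_le_of_one_le (one_le_pow₀ h2) h1
  set y := ∑ i, (mm D i : ℝ) * Real.log (A i) with hy
  have hy0 : 0 ≤ y := Finset.sum_nonneg fun i _ => mul_nonneg (by positivity) (Real.log_nonneg (hA1 i))
  have key : 0 ≤ Real.log ε + y := by
    apply limit_arg (t := t) (E := E) (r := r) (k0 := k0) hE hr _ _ hy0
    intro n hn
    obtain ⟨a, μ, hdet, hrow, hge, hsum⟩ := hrows n (by omega)
    have h1 := core_ineq K (k := n - k0) D hD Q hQ hQ0 ξ ε hε0 hε1 hM a μ hdet hrow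
      (fun s => by have := hge s; omega) (by omega) (by omega)
    have hpos : ∀ i ∈ Finset.univ, A i ^ (mm D i * ∑ s, a s i) ≠ 0 := fun i _ =>
      pow_ne_zero _ (by have := hA1 i; positivity)
    have h2 := Real.log_nonneg h1
    rw [Real.log_mul (by positivity) (Finset.prod_ne_zero_iff.mpr hpos), Real.log_prod hpos,
      Real.log_pow] at h2
    simp only [Real.log_pow] at h2
    push_cast at h2
    set U : ℝ := (r * (n * (n + t).choose t) + (t + 1) * n * (E * n + t).choose t
        - (t + 1) * n * (r * (n - k0 + t).choose t)) with hU
    have h3 : ∀ i, ((t : ℝ) + 1) * ∑ s, (a s i : ℝ) ≤ U := by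
      intro i
      have := hsum i
      have h4 : (((t + 1) * ∑ s, a s i + (t + 1) * n * (r * (n - k0 + t).choose t) : ℕ) : ℝ)
        ≤ ((r * (n * (n + t).choose t) + (t + 1) * n * (E * n + t).choose t : ℕ) : ℝ) := by
        exact_mod_cast this
      push_cast at h4
      rw [hU]
      linarith
    have h5 : (t + 1) * ∑ i, (mm D i : ℝ) * (∑ s, (a s i : ℝ)) * Real.log (A i) ≤ U * y := by
      rw [hy, Finset.mul_sum, Finset.mul_sum]
      apply Finset.sum_le_sum
      intro i _
      have h6 := mul_le_mul_of_nonneg_right (h3 i)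
        (mul_nonneg (Nat.cast_nonneg (α := ℝ) (mm D i)) (Real.log_nonneg (hA1 i)))
      linarith
    have h7 : (0 : ℝ) ≤ (t + 1) * (((∏ j, (D j : ℝ)) ^ t * ((n - k0).choose (t + 1) : ℝ)) * Real.log ε +
        ∑ i, (mm D i : ℝ) * (∑ s, (a s i : ℝ)) * Real.log (A i)) := mul_nonneg (by positivity) h2
    have h8 : (E : ℝ) = ∏ j, (D j : ℝ) := by rw [hEdef]; push_cast; rfl
    rw [h8]
    linarith
  have h9 : Real.log ((∏ i, A i ^ mm D i) * ε) = Real.log ε + y := by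
    rw [Real.log_mul _ hε0.ne', Real.log_prod, add_comm]
    · simp only [Real.log_pow, hy]
    · exact fun i _ => pow_ne_zero _ (by have := hA1 i; positivity)
    · exact Finset.prod_ne_zero_iff.mpr fun i _ => pow_ne_zero _ (by have := hA1 i; positivity)
  rw [← h9] at key
  rwa [Real.log_nonneg_iff] at key
  exact mul_pos (Finset.prod_pos fun i _ => pow_pos (by have := hA1 i; positivity) _) hε0

end P5b

end WrapP5b


section P5c
open MvPolynomial

lemma t_zero_case (K : IntermediateField ℚ ℂ) [NumberField K] (D : ℕ)
    (Q : MvPolynomial (Fin (0 + 1)) K) (hQ : Q.IsHomogeneous D) (hQ0 : Q ≠ 0) (ξ : Fin 0 → ℂ) :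
    1 ≤ ‖(MvPolynomial.aeval (Fin.cons 1 ξ : Fin (0 + 1) → ℂ) Q : ℂ)‖ / polyNorm K Q := by
  have hsub : Subsingleton (Fin (0 + 1)) := inferInstanceAs (Subsingleton (Fin 1))
  have hp : 0 < polyNorm K Q := sN_pos K Q hQ0 (algebraMap K ℂ)
  have hz : (Fin.cons 1 ξ : Fin (0 + 1) → ℂ) = fun _ => 1 := by
    funext i; rw [Subsingleton.elim i 0]; rfl
  have hu : ∀ m, Q.coeff m ≠ 0 → m = Finsupp.single 0 D := by
    intro m hm
    have h := hQ hm
    ext i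
    rw [Subsingleton.elim i 0]
    rw [← h]
    simp [Finsupp.weight_apply, Finsupp.sum_fintype]
  have hQm : Q = monomial (Finsupp.single 0 D) (Q.coeff (Finsupp.single 0 D)) := by
    refine MvPolynomial.ext _ _ fun m => ?_
    rw [coeff_monomial]
    split_ifs with h
    · rw [h]
    · by_contra h'
      exact h (hu m h').symm
  have hv : (MvPolynomial.aeval (Fin.cons 1 ξ : Fin (0 + 1) → ℂ) Q : ℂ)
      = algebraMap K ℂ (Q.coeff (Finsupp.single 0 D)) := by
    rw [hz]
    conv_lhs => rw [hQm]
    rw [aeval_monomial]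
    simp
  rw [one_le_div hp, hv]
  obtain ⟨m0, hm0⟩ := MvPolynomial.ne_zero_iff.mp hQ0
  have : Nonempty ↥Q.support := ⟨⟨m0, mem_support_iff.mpr hm0⟩⟩
  refine ciSup_le fun m => ?_
  rw [hu m (mem_support_iff.mp m.2)]
  exact le_rfl

end P5c

theorem resultant_height_lower_bound
    (K : IntermediateField ℚ ℂ) [NumberField K]
    (d : ℕ) (hd : d = Module.finrank ℚ K)
    (t : ℕ) (D : Fin (t + 1) → ℕ) (hD : ∀ i, 1 ≤ D i)
    (Q : Fin (t + 1) → MvPolynomial (Fin (t + 1)) K)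
    (hQ : ∀ i, (Q i).IsHomogeneous (D i))
    (hnz : ¬∃ z : Fin (t + 1) → ℂ, z ≠ 0 ∧ ∀ i, MvPolynomial.aeval z (Q i) = 0)
    (ξ : Fin t → ℂ) :
    1 ≤ ((t : ℝ) + 1) ^ (4 * d * (t + 1) * ∏ i, D i)
        * (∏ i, polyH K (Q i) ^ (d * ∏ j ∈ Finset.univ.erase i, D j))
        * ⨆ i, ‖(MvPolynomial.aeval (Fin.cons 1 ξ) (Q i) : ℂ)‖ / polyNorm K (Q i) := by
  subst hd
  have hQ0 := (exists_rows K D hD Q hQ hnz).1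
  have hp : ∀ i, 0 < polyNorm K (Q i) := fun i => sN_pos K (Q i) (hQ0 i) (algebraMap K ℂ)
  have hle : ∀ i, ‖(MvPolynomial.aeval (Fin.cons 1 ξ) (Q i) : ℂ)‖ / polyNorm K (Q i) ≤
      ⨆ i, ‖(MvPolynomial.aeval (Fin.cons 1 ξ) (Q i) : ℂ)‖ / polyNorm K (Q i) := fun i =>
    le_ciSup (f := fun i => ‖(MvPolynomial.aeval (Fin.cons 1 ξ) (Q i) : ℂ)‖ / polyNorm K (Q i))
      (Set.finite_range _).bddAbove i
  set ε : ℝ := ⨆ i, ‖(MvPolynomial.aeval (Fin.cons 1 ξ) (Q i) : ℂ)‖ / polyNorm K (Q i) with hε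
  have hM : ∀ i, ‖(MvPolynomial.aeval (Fin.cons 1 ξ) (Q i) : ℂ)‖ ≤ ε * polyNorm K (Q i) :=
    fun i => (div_le_iff₀ (hp i)).mp (hle i)
  have ht1 : (1 : ℝ) ≤ (t : ℝ) + 1 := by
    have : (0 : ℝ) ≤ t := Nat.cast_nonneg t
    linarith
  have hHone : ∀ i, 1 ≤ polyH K (Q i) ^ Module.finrank ℚ K := fun i =>
    one_le_polyH_pow K (Q i) (hQ0 i)
  have hH : ∏ i, polyH K (Q i) ^ (Module.finrank ℚ K * ∏ j ∈ Finset.univ.erase i, D j)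
      = ∏ i, (polyH K (Q i) ^ Module.finrank ℚ K) ^ mm D i :=
    Finset.prod_congr rfl fun i _ => by rw [pow_mul]; rfl
  rw [hH]
  have hpow : ((t : ℝ) + 1) ^ (4 * Module.finrank ℚ K * (t + 1) * ∏ i, D i)
      = ∏ i, ((((t : ℝ) + 1) ^ (4 * D i)) ^ Module.finrank ℚ K) ^ mm D i := by
    have h1 : ∀ i, ((((t : ℝ) + 1) ^ (4 * D i)) ^ Module.finrank ℚ K) ^ mm D i
        = ((t : ℝ) + 1) ^ (4 * Module.finrank ℚ K * ∏ i, D i) := by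
      intro i
      rw [← pow_mul, ← pow_mul, ← D_mul_mm D i]
      congr 1; ring
    rw [Finset.prod_congr rfl fun i _ => h1 i, Finset.prod_const, Finset.card_univ,
      Fintype.card_fin, ← pow_mul]
    congr 1; ring
  have hHprod : 1 ≤ ∏ i, (polyH K (Q i) ^ Module.finrank ℚ K) ^ mm D i := by
    have := Finset.prod_le_prod (s := Finset.univ) (f := fun _ : Fin (t + 1) => (1 : ℝ))
      (g := fun i => (polyH K (Q i) ^ Module.finrank ℚ K) ^ mm D i)
      (fun _ _ => zero_le_one) (fun i _ => one_le_pow₀ (hHone i))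
    simpa using this
  by_cases hε1 : 1 ≤ ε
  · exact one_le_mul_of_one_le_of_one_le
      (one_le_mul_of_one_le_of_one_le (one_le_pow₀ ht1) hHprod) hε1
  push Not at hε1
  have hε0 : 0 < ε := by
    by_contra h
    push Not at h
    refine hnz ⟨Fin.cons 1 ξ, fun h0 => ?_, fun i => ?_⟩
    · have := congrFun h0 0
      simp at this
    · have h2 : ε * polyNorm K (Q i) ≤ 0 := mul_nonpos_of_nonpos_of_nonneg h (hp i).le
      exact norm_le_zero_iff.mp ((hM i).trans h2)
  have ht : 1 ≤ t := by
    by_contra h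
    obtain rfl : t = 0 := by omega
    exact absurd (t_zero_case K (D 0) (Q 0) (hQ 0) (hQ0 0) ξ) (not_le.mpr ((hle 0).trans_lt hε1))
  have hs := small_case K D hD Q hQ hnz ξ ε hε0 hε1 hM
  refine hs.trans (mul_le_mul_of_nonneg_right ?_ hε0.le)
  rw [hpow, ← Finset.prod_mul_distrib]
  refine Finset.prod_le_prod (fun i _ => ?_) fun i _ => ?_
  · have := hHone i
    positivity
  · rw [← mul_pow (((((t : ℝ) + 1) ^ (4 * D i)) ^ Module.finrank ℚ K))]
    have hx : (2 : ℝ) ≤ ((t : ℝ) + 1) ^ D i := by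
      have h2 : (2 : ℝ) ≤ (t : ℝ) + 1 := by
        have : (1 : ℝ) ≤ t := by exact_mod_cast ht
        linarith
      exact h2.trans (le_self_pow₀ ht1 (by have := hD i; omega))
    have hx4 : ((t : ℝ) + 1) ^ D i + 2 ≤ ((t : ℝ) + 1) ^ (4 * D i) := by
      rw [mul_comm, pow_mul]
      set x := ((t : ℝ) + 1) ^ D i
      have h3 : x * 2 ≤ x * x := by gcongr
      have h4 : x * x * 1 ≤ x * x * (x * x) := by gcongr; nlinarith
      calc x + 2 ≤ x * 2 := by linarith
        _ ≤ x * x * (x * x) := by linarith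
        _ = x ^ 4 := by ring
    have h7 : 0 ≤ polyH K (Q i) ^ Module.finrank ℚ K := zero_le_one.trans (hHone i)
    have h8 : 0 ≤ ((t : ℝ) + 1) ^ D i + 2 := by linarith
    exact pow_le_pow_left₀ (mul_nonneg (pow_nonneg h8 _) h7)
      (mul_le_mul_of_nonneg_right (pow_le_pow_left₀ h8 hx4 _) h7) _
end
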